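/- arXiv:1712.09590 — 7 statements merged into one kernel-verified Lean document; each statement's English description precedes it below -/
import Mathlib

section
/- Let n > 2 be an integer and A > 0 a real constant. For all real numbers C, ρ with C > ρ > 1 and C² + ρ² < n, there exists τ₀ ∈ ℝ such that for every τ > τ₀ and every z ∈ (−ρ, ρ), the function w̄(z) = C − √(ρ² − z²) satisfies the strict super-solution inequality − w̄''(z)/(1 + w̄'(z)²) + z·w̄'(z) − w̄(z) + (n−1)/w̄(z) − √2·A·e^{−τ}·√(1 + w̄'(z)²) > 0, where w̄'(z) = z/√(ρ² − z²) and w̄''(z) = ρ²/(ρ² − z²)^{3/2}. -/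
/-- If `C² + ρ² < m + 1`, the driving-free rescaled graph operator on the circular profile,
multiplied by `s = √(ρ² − z²)`, exceeds `ρ² − 1`. -/
theorem sq_sub_one_lt_circle_operator {C ρ m s : ℝ} (hρ : 1 < ρ)
    (hm : C ^ 2 + ρ ^ 2 < m + 1) (hs : 0 < s) (hsC : s < C) :
    ρ ^ 2 - 1 < ρ ^ 2 - 1 - C * s + m * s / (C - s) := by
  have hCs : 0 < C - s := sub_pos.mpr hsC
  have h : C * s < m * s / (C - s) := by
    rw [lt_div_iff₀ hCs]
    have hCm : C ^ 2 < m := by nlinarith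
    nlinarith [mul_pos (hs.trans hsC) (mul_pos hs hs), mul_lt_mul_of_pos_right hCm hs]
  linarith

/-- For `n > 2`, `A > 0`, and all `C > ρ > 1` with `C² + ρ² < n`, there is `τ₀`
such that for `τ > τ₀` and `z ∈ (−ρ, ρ)` the profile `w̄(z) = C − √(ρ² − z²)` is a strict
super-solution of the rescaled graph equation. -/
theorem supersolution_rescaled_n_gt_two (n : ℕ) (hn : 2 < n) (A : ℝ) (hA : 0 < A) :
    ∀ C ρ : ℝ, 1 < ρ → ρ < C → C ^ 2 + ρ ^ 2 < (n : ℝ) →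
    ∃ τ₀ : ℝ, ∀ τ : ℝ, τ₀ < τ → ∀ z : ℝ, z ∈ Set.Ioo (-ρ) ρ →
      0 < -(ρ ^ 2 / (ρ ^ 2 - z ^ 2) ^ ((3 : ℝ) / 2)
              / (1 + (z / Real.sqrt (ρ ^ 2 - z ^ 2)) ^ 2))
          + z * (z / Real.sqrt (ρ ^ 2 - z ^ 2))
          - (C - Real.sqrt (ρ ^ 2 - z ^ 2))
          + ((n : ℝ) - 1) / (C - Real.sqrt (ρ ^ 2 - z ^ 2))
          - Real.sqrt 2 * A * Real.exp (-τ) *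
              Real.sqrt (1 + (z / Real.sqrt (ρ ^ 2 - z ^ 2)) ^ 2) := by
  intro C ρ hρ hρC hn'
  have hρ0 : 0 < ρ := by linarith
  have hρ1 : 0 < ρ ^ 2 - 1 := by nlinarith
  have hK : 0 < Real.sqrt 2 * A * ρ := by positivity
  refine ⟨Real.log (Real.sqrt 2 * A * ρ / (ρ ^ 2 - 1)), fun τ hτ z hz => ?_⟩
  have hε : Real.sqrt 2 * A * ρ * Real.exp (-τ) < ρ ^ 2 - 1 := by
    have h := (Real.log_lt_iff_lt_exp (by positivity)).mp hτ
    rw [div_lt_iff₀ hρ1] at h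
    rw [Real.exp_neg, ← div_eq_mul_inv, div_lt_iff₀ (Real.exp_pos τ)]
    linarith
  have hpos : 0 < ρ ^ 2 - z ^ 2 := by nlinarith [hz.1, hz.2]
  have hpow : (ρ ^ 2 - z ^ 2) ^ ((3 : ℝ) / 2) = Real.sqrt (ρ ^ 2 - z ^ 2) ^ 3 := by
    rw [Real.sqrt_eq_rpow, ← Real.rpow_mul_natCast hpos.le]
    norm_num
  rw [hpow]
  have hsq : Real.sqrt (ρ ^ 2 - z ^ 2) ^ 2 = ρ ^ 2 - z ^ 2 := Real.sq_sqrt hpos.le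
  have hs : 0 < Real.sqrt (ρ ^ 2 - z ^ 2) := Real.sqrt_pos.mpr hpos
  generalize Real.sqrt (ρ ^ 2 - z ^ 2) = s at hsq hs ⊢
  have hsC : s < C := (abs_le_of_sq_le_sq' (by nlinarith [sq_nonneg z]) hρ0.le).2.trans_lt hρC
  have hCs : C - s ≠ 0 := (sub_pos.mpr hsC).ne'
  have hgrad : 1 + (z / s) ^ 2 = (ρ / s) ^ 2 := by
    field_simp
    linarith
  rw [hgrad, Real.sqrt_sq (by positivity)]
  have hmain := sq_sub_one_lt_circle_operator (m := (n : ℝ) - 1) hρ (by linarith) hs hsC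
  have hz2 : z * (z / s) = (ρ ^ 2 - s ^ 2) / s := by
    rw [hsq]
    ring
  have hrw : -(ρ ^ 2 / s ^ 3 / (ρ / s) ^ 2) + z * (z / s) - (C - s) + ((n : ℝ) - 1) / (C - s)
      - Real.sqrt 2 * A * Real.exp (-τ) * (ρ / s)
      = (ρ ^ 2 - 1 - C * s + ((n : ℝ) - 1) * s / (C - s)
        - Real.sqrt 2 * A * ρ * Real.exp (-τ)) / s := by
    rw [hz2]
    field_simp
    ring
  rw [hrw]
  exact div_pos (by linarith) hs
end

section
/- Let A > 0 be a real constant. Fix θ ∈ (0,1) and ε₀ ∈ (0, 2θ/9). Then for all real numbers ρ, C with 1 + θ·ε₀ < ρ < C < 1 + ε₀, there exists τ₀ ∈ ℝ such that for every τ > τ₀ and every z ∈ (−ρ, ρ), the function w̄(z) = C − √(ρ² − z²) satisfies the strict super-solution inequality − w̄''(z)/(1 + w̄'(z)²) + z·w̄'(z) − w̄(z) + 1/w̄(z) − √2·A·e^{−τ}·√(1 + w̄'(z)²) > 0, where w̄'(z) = z/√(ρ² − z²) and w̄''(z) = ρ²/(ρ² − z²)^{3/2}. -/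
theorem Real.rpow_three_halves {x : ℝ} (hx : 0 ≤ x) : x ^ ((3 : ℝ) / 2) = √x ^ 3 := by
  rw [Real.sqrt_eq_rpow, ← Real.rpow_natCast, ← Real.rpow_mul hx]
  norm_num

/-- On a circular arc of radius `ρ`, with `s = √(ρ² - z²)`, the rescaled operator applied to
`C - s` is an explicit function of `s`. -/
theorem rescaled_operator_arc {ρ z : ℝ} (C K : ℝ) (hz : z ∈ Set.Ioo (-ρ) ρ) :
    -(ρ ^ 2 / (ρ ^ 2 - z ^ 2) ^ ((3 : ℝ) / 2) / (1 + (z / √(ρ ^ 2 - z ^ 2)) ^ 2))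
        + z * (z / √(ρ ^ 2 - z ^ 2)) - (C - √(ρ ^ 2 - z ^ 2))
        + 1 / (C - √(ρ ^ 2 - z ^ 2)) - K * √(1 + (z / √(ρ ^ 2 - z ^ 2)) ^ 2)
      = (ρ ^ 2 - 1 - K * ρ) / √(ρ ^ 2 - z ^ 2) + 1 / (C - √(ρ ^ 2 - z ^ 2)) - C := by
  have hρ : 0 < ρ := by linarith [hz.1, hz.2]
  have hpos : 0 < ρ ^ 2 - z ^ 2 := by nlinarith [hz.1, hz.2]
  rw [Real.rpow_three_halves hpos.le]
  have hs : 0 < √(ρ ^ 2 - z ^ 2) := Real.sqrt_pos.2 hpos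
  have hsq : √(ρ ^ 2 - z ^ 2) ^ 2 = ρ ^ 2 - z ^ 2 := Real.sq_sqrt hpos.le
  generalize √(ρ ^ 2 - z ^ 2) = s at hs hsq ⊢
  have hslope : 1 + (z / s) ^ 2 = (ρ / s) ^ 2 := by
    field_simp
    linarith
  have hcurv : ρ ^ 2 / s ^ 3 / (ρ / s) ^ 2 = 1 / s := by field_simp
  have hdrift : z * (z / s) = ρ ^ 2 / s - s := by
    field_simp
    linarith
  rw [hslope, Real.sqrt_sq (by positivity), hcurv, hdrift]
  ring

/-- A two-term Cauchy-Schwarz (Titu) estimate. -/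
theorem lt_div_add_one_div_sub {a C s ε : ℝ} (hs : 0 < s) (hsC : s < C) (hε : 0 < ε)
    (ha : ε ^ 2 ≤ a) (hC : C < 1 + ε) : C < a / s + 1 / (C - s) := by
  have hCs : 0 < C - s := sub_pos.2 hsC
  have htitu : (ε + 1) ^ 2 / (s + (C - s)) ≤ ε ^ 2 / s + 1 ^ 2 / (C - s) :=
    by
    rw [div_add_div _ _ hs.ne' hCs.ne', div_le_div_iff₀ (by linarith) (by positivity)]
    nlinarith [sq_nonneg (ε * (C - s) - s)]
  calc C < (ε + 1) ^ 2 / (s + (C - s)) := by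
        rw [add_sub_cancel, lt_div_iff₀ (hs.trans hsC)]
        nlinarith
    _ ≤ ε ^ 2 / s + 1 / (C - s) := by simpa using htitu
    _ ≤ a / s + 1 / (C - s) := by gcongr

/-- The `n = 2` super-solution estimate. Fix `θ ∈ (0,1)`, `ε₀ ∈ (0, 2θ/9)`.
For all `ρ, C` with `1 + θε₀ < ρ < C < 1 + ε₀` there exists `τ₀` such that for `τ > τ₀` and
`z ∈ (−ρ, ρ)` the profile `w̄(z) = C − √(ρ² − z²)` is a strict super-solution of the rescaled
graph equation with `n = 2`. -/
theorem supersolution_rescaled_n_eq_two (A : ℝ) (hA : 0 < A)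
    (θ ε₀ : ℝ) (hθ : θ ∈ Set.Ioo (0 : ℝ) 1) (hε₀ : ε₀ ∈ Set.Ioo (0 : ℝ) (2 * θ / 9)) :
    ∀ ρ C : ℝ, 1 + θ * ε₀ < ρ → ρ < C → C < 1 + ε₀ →
    ∃ τ₀ : ℝ, ∀ τ : ℝ, τ₀ < τ → ∀ z : ℝ, z ∈ Set.Ioo (-ρ) ρ →
      0 < -(ρ ^ 2 / (ρ ^ 2 - z ^ 2) ^ ((3 : ℝ) / 2)
              / (1 + (z / Real.sqrt (ρ ^ 2 - z ^ 2)) ^ 2))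
          + z * (z / Real.sqrt (ρ ^ 2 - z ^ 2))
          - (C - Real.sqrt (ρ ^ 2 - z ^ 2))
          + 1 / (C - Real.sqrt (ρ ^ 2 - z ^ 2))
          - Real.sqrt 2 * A * Real.exp (-τ) *
              Real.sqrt (1 + (z / Real.sqrt (ρ ^ 2 - z ^ 2)) ^ 2) := by
  intro ρ C hρ hρC hC
  obtain ⟨hθ0, hθ1⟩ := hθ
  obtain ⟨hε0, hε⟩ := hε₀
  have hρ0 : 0 < ρ := by nlinarith
  have hgap : 0 < ρ ^ 2 - 1 - ε₀ ^ 2 := by nlinarith [mul_pos hθ0 hε0]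
  have hlim : Filter.Tendsto (fun τ : ℝ => √2 * A * Real.exp (-τ) * ρ) Filter.atTop (nhds 0) := by
    simpa using (Real.tendsto_exp_neg_atTop_nhds_zero.const_mul (√2 * A)).mul_const ρ
  obtain ⟨τ₀, hτ₀⟩ := Filter.eventually_atTop.1 (hlim.eventually_lt_const hgap)
  refine ⟨τ₀, fun τ hτ z hz => ?_⟩
  have hs : 0 < √(ρ ^ 2 - z ^ 2) := Real.sqrt_pos.2 (by nlinarith [hz.1, hz.2])
  have hsρ : √(ρ ^ 2 - z ^ 2) ≤ ρ := Real.sqrt_le_iff.2 ⟨hρ0.le, by nlinarith [sq_nonneg z]⟩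
  rw [rescaled_operator_arc _ _ hz, sub_pos]
  exact lt_div_add_one_div_sub hs (hsρ.trans_lt hρC) hε0 (by linarith [hτ₀ τ hτ.le]) hC
end

section
/- Fix θ ∈ (0,1) and ε₀ ∈ (0, 2θ/9). Then for all real numbers ρ, C with 1 + θ·ε₀ < ρ < C < 1 + ε₀, the following inequality holds: −(C² + ρ² − 2)²/(4C) + (ρ² − 1)·C ≥ (2θε₀ − 9ε₀²)/(1 + θε₀) > 0. -/
/-- the key algebraic estimate in the `n = 2` super-solution construction. -/
theorem algebraic_estimate_n_eq_two (θ ε₀ : ℝ)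
    (hθ : θ ∈ Set.Ioo (0 : ℝ) 1) (hε₀ : ε₀ ∈ Set.Ioo (0 : ℝ) (2 * θ / 9)) :
    ∀ ρ C : ℝ, 1 + θ * ε₀ < ρ → ρ < C → C < 1 + ε₀ →
      (-(C ^ 2 + ρ ^ 2 - 2) ^ 2 / (4 * C) + (ρ ^ 2 - 1) * C
          ≥ (2 * θ * ε₀ - 9 * ε₀ ^ 2) / (1 + θ * ε₀))
      ∧ (2 * θ * ε₀ - 9 * ε₀ ^ 2) / (1 + θ * ε₀) > 0 := by
  obtain ⟨hθ0, hθ1⟩ := hθ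
  obtain ⟨he0, he1⟩ := hε₀
  intro ρ C hρ hρC hC
  have hR : 0 < 2 * θ * ε₀ - 9 * ε₀ ^ 2 := by nlinarith
  have ht0 : 0 < θ * ε₀ := mul_pos hθ0 he0
  have hte : θ * ε₀ < ε₀ := by nlinarith
  rw [mul_assoc] at hR ⊢
  generalize θ * ε₀ = t at *
  have he : ε₀ < 2 / 9 := by linarith
  have hC0 : 0 < C := by linarith
  refine ⟨?_, div_pos hR (by linarith)⟩
  have hlhs : -(C ^ 2 + ρ ^ 2 - 2) ^ 2 / (4 * C) + (ρ ^ 2 - 1) * C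
      = (ρ ^ 2 - 1 - ((C - ρ) * ((C + ρ) / 2)) ^ 2) / C := by
    field_simp
    ring
  rw [hlhs, ge_iff_le, div_le_div_iff₀ (by linarith) hC0]
  have hgap : ((C - ρ) * ((C + ρ) / 2)) ^ 2 ≤ (ε₀ * (11 / 9)) ^ 2 := by
    have h₁ : 0 ≤ C - ρ := by linarith
    have h₂ : 0 ≤ (C + ρ) / 2 := by linarith
    have h₃ : (C + ρ) / 2 ≤ 11 / 9 := by linarith
    have h₄ : C - ρ ≤ ε₀ := by linarith
    exact pow_le_pow_left₀ (mul_nonneg h₁ h₂) (mul_le_mul h₄ h₃ h₂ he0.le) 2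
  have hρ2 : (1 + t) ^ 2 ≤ ρ ^ 2 := by gcongr
  calc (2 * t - 9 * ε₀ ^ 2) * C ≤ (2 * t - 9 * ε₀ ^ 2) * (1 + ε₀) := by gcongr
    _ ≤ ((1 + t) ^ 2 - 1 - (ε₀ * (11 / 9)) ^ 2) * (1 + t) := by
      nlinarith [mul_pos ht0 he0, pow_pos ht0 3, pow_pos he0 3, sq_nonneg t,
        mul_pos he0 (sub_pos.2 hte), mul_pos (pow_pos he0 2) (sub_pos.2 hte)]
    _ ≤ _ := by gcongr
end

section
/- Let n > 2 be an integer and A > 0 a real constant, and let C, ρ be real numbers with C > ρ > 1 and C² + ρ² < n. Then there exists T₀ > 0 such that for every T ∈ (0, T₀], the function ū(x,t) = C·√(2(T−t)) − √(2ρ²(T−t) − x²) satisfies the strict super-solution inequality ∂_t ū(x,t) > (∂²_{xx} ū(x,t))/(1 + (∂_x ū(x,t))²) − (n−1)/ū(x,t) + A·√(1 + (∂_x ū(x,t))²) for all t ∈ (0, T) and all x with |x| < ρ·√(2(T−t)); moreover ū(x,t) > 0 on this region. -/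
/-- The self-similar profile `ū(x,t) = C·√(2(T−t)) − √(2ρ²(T−t) − x²)`. -/
noncomputable def ubar (C ρ T : ℝ) (x t : ℝ) : ℝ :=
  C * Real.sqrt (2 * (T - t)) - Real.sqrt (2 * ρ ^ 2 * (T - t) - x ^ 2)

/-- Inside its domain, `√(a - y²)` has derivative `-(y / √(a - y²))`. -/
theorem hasDerivAt_sqrt_sub_sq {a y : ℝ} (h : 0 < a - y ^ 2) :
    HasDerivAt (fun z => √(a - z ^ 2)) (-(y / √(a - y ^ 2))) y := by
  have h1 : HasDerivAt (fun z : ℝ => a - z ^ 2) (-(2 * y)) y := by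
    simpa using (hasDerivAt_pow 2 y).const_sub a
  convert h1.sqrt h.ne' using 1
  have := (Real.sqrt_pos.2 h).ne'
  field_simp

theorem hasDerivAt_ubar_space {C ρ T t y : ℝ} (h : 0 < 2 * ρ ^ 2 * (T - t) - y ^ 2) :
    HasDerivAt (fun z => ubar C ρ T z t) (y / √(2 * ρ ^ 2 * (T - t) - y ^ 2)) y := by
  simpa [ubar] using (hasDerivAt_sqrt_sub_sq h).const_sub (C * √(2 * (T - t)))

theorem deriv_deriv_ubar_space {C ρ T t x : ℝ} (h : 0 < 2 * ρ ^ 2 * (T - t) - x ^ 2) :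
    deriv (deriv fun z => ubar C ρ T z t) x =
      2 * ρ ^ 2 * (T - t) / √(2 * ρ ^ 2 * (T - t) - x ^ 2) ^ 3 := by
  have hev : (deriv fun z => ubar C ρ T z t) =ᶠ[nhds x]
      fun y => y / √(2 * ρ ^ 2 * (T - t) - y ^ 2) := by
    have hc : Continuous fun y : ℝ => 2 * ρ ^ 2 * (T - t) - y ^ 2 := by fun_prop
    filter_upwards [hc.continuousAt.eventually (lt_mem_nhds h)] with y hy
    exact (hasDerivAt_ubar_space hy).deriv
  have hs := Real.sqrt_pos.2 h
  rw [hev.deriv_eq, ((hasDerivAt_id' x).fun_div (hasDerivAt_sqrt_sub_sq h) hs.ne').deriv]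
  have hsq := Real.sq_sqrt h.le
  set s := √(2 * ρ ^ 2 * (T - t) - x ^ 2)
  field_simp
  linear_combination hsq

theorem hasDerivAt_ubar_time {C ρ T t x : ℝ} (ht : t < T)
    (h : 0 < 2 * ρ ^ 2 * (T - t) - x ^ 2) :
    HasDerivAt (fun s => ubar C ρ T x s)
      (-(C / √(2 * (T - t))) + ρ ^ 2 / √(2 * ρ ^ 2 * (T - t) - x ^ 2)) t := by
  have hL : 0 < 2 * (T - t) := by linarith
  have h0 : HasDerivAt (fun s : ℝ => T - s) (-1) t := (hasDerivAt_id' t).const_sub T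
  have h1 := ((h0.const_mul 2).sqrt hL.ne').const_mul C
  have h2 := ((h0.const_mul (2 * ρ ^ 2)).sub_const (x ^ 2)).sqrt h.ne'
  refine (h1.fun_sub h2).congr_deriv ?_
  have := (Real.sqrt_pos.2 hL).ne'
  have := (Real.sqrt_pos.2 h).ne'
  field_simp
  ring

/-- The super-solution inequality in terms of `L = √(2(T-t))` and `s = √(ρ²L² - x²)`. -/
theorem selfsimilar_algebraic_inequality {N A C ρ L s : ℝ} (hA : 0 < A) (hρ : 0 < ρ)
    (hC : 0 < C) (hL : 0 < L) (hs : 0 < s) (hsC : s < C * L) (hsum : C ^ 2 + ρ ^ 2 < N)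
    (hAL : A * ρ * L < ρ ^ 2 - 1) :
    1 / s - (N - 1) / (C * L - s) + A * (ρ * L / s) < -(C / L) + ρ ^ 2 / s := by
  have hd : 0 < C * L - s := sub_pos.2 hsC
  have h1 : 0 < ρ ^ 2 - 1 - A * ρ * L := sub_pos.2 hAL
  have h2 : 0 < N - C ^ 2 - ρ ^ 2 := by linarith
  have key : -(C / L) + ρ ^ 2 / s - (1 / s - (N - 1) / (C * L - s) + A * (ρ * L / s)) =
      (C * L ^ 2 * (ρ ^ 2 - 1 - A * ρ * L) + s * L * (N - C ^ 2 - ρ ^ 2) + C * s ^ 2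
        + A * ρ * L ^ 2 * s) / (L * s * (C * L - s)) := by
    have := hd.ne'
    field_simp
    ring
  rw [← sub_pos, key]
  positivity

/-- for `n > 2`, `A > 0`, `C > ρ > 1` with `C² + ρ² < n`, there exists `T₀ > 0`
such that for every `T ∈ (0, T₀]` the function `ū` is a positive strict super-solution of the
rotationally symmetric graph equation on `{|x| < ρ√(2(T−t))}`, `0 < t < T`. -/
theorem selfsimilar_supersolution (n : ℕ) (hn : 2 < n) (A C ρ : ℝ)
    (hA : 0 < A) (hρ : 1 < ρ) (hC : ρ < C) (hsum : C ^ 2 + ρ ^ 2 < (n : ℝ)) :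
    ∃ T₀ > (0 : ℝ), ∀ T ∈ Set.Ioc (0 : ℝ) T₀, ∀ t ∈ Set.Ioo (0 : ℝ) T, ∀ x : ℝ,
      |x| < ρ * Real.sqrt (2 * (T - t)) →
      0 < ubar C ρ T x t ∧
      deriv (fun s => ubar C ρ T x s) t >
        deriv (deriv (fun y => ubar C ρ T y t)) x
            / (1 + (deriv (fun y => ubar C ρ T y t) x) ^ 2)
          - ((n : ℝ) - 1) / ubar C ρ T x t
          + A * Real.sqrt (1 + (deriv (fun y => ubar C ρ T y t) x) ^ 2) := by
  have hρ0 : 0 < ρ := by linarith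
  have hC0 : 0 < C := by linarith
  have hρ1 : 0 < ρ ^ 2 - 1 := by nlinarith
  refine ⟨((ρ ^ 2 - 1) / (A * ρ)) ^ 2 / 2, by positivity, ?_⟩
  rintro T ⟨-, hT⟩ t ⟨ht0, htT⟩ x hx
  have hτ : 0 < 2 * (T - t) := by linarith
  have hL := Real.sqrt_pos.2 hτ
  have hLsq := Real.sq_sqrt hτ.le
  have hxsq : x ^ 2 < (ρ * √(2 * (T - t))) ^ 2 := sq_lt_sq' (abs_lt.1 hx).1 (abs_lt.1 hx).2
  have hpos : 0 < 2 * ρ ^ 2 * (T - t) - x ^ 2 := by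
    rw [mul_pow, hLsq] at hxsq
    linarith
  have hAL : A * ρ * √(2 * (T - t)) < ρ ^ 2 - 1 := by
    rw [← lt_div_iff₀' (by positivity)]
    exact (Real.sqrt_lt' (by positivity)).2 (by linarith)
  have hs := Real.sqrt_pos.2 hpos
  have hssq := Real.sq_sqrt hpos.le
  rw [(hasDerivAt_ubar_time htT hpos).deriv, deriv_deriv_ubar_space hpos,
    (hasDerivAt_ubar_space hpos).deriv, ubar]
  set L := √(2 * (T - t))
  set s := √(2 * ρ ^ 2 * (T - t) - x ^ 2)
  have hsC : s < C * L := by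
    have : s ≤ ρ * L := abs_le_of_sq_le_sq' (by nlinarith [sq_nonneg x]) (by positivity) |>.2
    nlinarith
  have hgrad : 1 + (x / s) ^ 2 = (ρ * L / s) ^ 2 := by
    field_simp
    rw [hssq, hLsq]
    ring
  have hcurv : 2 * ρ ^ 2 * (T - t) / s ^ 3 / (ρ * L / s) ^ 2 = 1 / s := by
    field_simp
    rw [hLsq]
  refine ⟨sub_pos.2 hsC, ?_⟩
  rw [hgrad, hcurv, Real.sqrt_sq (by positivity)]
  exact selfsimilar_algebraic_inequality hA hρ0 hC0 hL hs hsC hsum hAL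
end

section
/- Let n ≥ 2 be an integer, A > 0 and R₀ > 0 real constants, δ > 0, and let R : [0, δ) → (0, ∞) be differentiable with R(0) = R₀ and R'(t) = A − n/R(t) for all t ∈ [0, δ). Set r(t) = t^{3/4} and define u(x,t) = √((r(t) + R(t))² − R₀²) − √(r(t)² − x²). Then there exists t* ∈ (0, δ) such that for all t ∈ (0, t*) and all x with |x| < R₀·r(t)/(R(t) + r(t)), one has u(x,t) > 0 and the strict sub-solution inequality ∂_t u(x,t) − (∂²_{xx} u(x,t))/(1 + (∂_x u(x,t))²) + (n−1)/u(x,t) − A·√(1 + (∂_x u(x,t))²) < 0. -/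
/-- `r(t) = t^{3/4}`. -/
noncomputable def rr (t : ℝ) : ℝ := t ^ ((3 : ℝ) / 4)

/-- The sub-solution `u(x,t) = √((r(t)+R(t))² − R₀²) − √(r(t)² − x²)`. -/
noncomputable def usub (R₀ : ℝ) (R : ℝ → ℝ) (x t : ℝ) : ℝ :=
  Real.sqrt ((rr t + R t) ^ 2 - R₀ ^ 2) - Real.sqrt ((rr t) ^ 2 - x ^ 2)

open Filter Topology

lemma rr_pos {t : ℝ} (ht : 0 < t) : 0 < rr t := Real.rpow_pos_of_pos ht _

lemma hasDerivAt_rr {t : ℝ} (ht : 0 < t) :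
    HasDerivAt rr (3 / 4 * t ^ (-(1 / 4) : ℝ)) t := by
  have h := Real.hasDerivAt_rpow_const (x := t) (p := (3 : ℝ) / 4) (Or.inl ht.ne')
  have e : (3 : ℝ) / 4 - 1 = -(1 / 4) := by norm_num
  rwa [e] at h

lemma tendsto_rpow_nhdsGT_zero {a : ℝ} (ha : 0 < a) :
    Tendsto (fun t : ℝ => t ^ a) (𝓝[>] 0) (𝓝 0) := by
  have h := (Real.continuousAt_rpow_const 0 a (Or.inr ha.le)).tendsto
  rw [Real.zero_rpow ha.ne'] at h
  exact h.mono_left nhdsWithin_le_nhds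

lemma hasDerivAt_usub_space (R₀ : ℝ) (R : ℝ → ℝ) {x t : ℝ} (h : 0 < rr t ^ 2 - x ^ 2) :
    HasDerivAt (fun y => usub R₀ R y t) (x / √(rr t ^ 2 - x ^ 2)) x := by
  have h1 : HasDerivAt (fun y : ℝ => rr t ^ 2 - y ^ 2) (-(2 * x)) x := by
    simpa using (hasDerivAt_pow 2 x).const_sub (rr t ^ 2)
  have h2 := (h1.sqrt h.ne').const_sub (√((rr t + R t) ^ 2 - R₀ ^ 2))
  exact h2.congr_deriv (by ring)

lemma deriv_deriv_usub_space (R₀ : ℝ) (R : ℝ → ℝ) {x t : ℝ} (h : 0 < rr t ^ 2 - x ^ 2) :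
    deriv (deriv (fun y => usub R₀ R y t)) x = rr t ^ 2 / √(rr t ^ 2 - x ^ 2) ^ 3 := by
  have hev : ∀ᶠ y in 𝓝 x, 0 < rr t ^ 2 - y ^ 2 :=
    (continuous_const.sub (continuous_pow 2)).continuousAt.eventually (lt_mem_nhds h)
  have heq : deriv (fun y => usub R₀ R y t) =ᶠ[𝓝 x] fun y => y / √(rr t ^ 2 - y ^ 2) :=
    hev.mono fun y hy => (hasDerivAt_usub_space R₀ R hy).deriv
  rw [heq.deriv_eq]
  have h1 : HasDerivAt (fun y : ℝ => rr t ^ 2 - y ^ 2) (-(2 * x)) x := by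
    simpa using (hasDerivAt_pow 2 x).const_sub (rr t ^ 2)
  have hw := Real.sqrt_pos.2 h
  have h2 := (hasDerivAt_id x).div (h1.sqrt h.ne') hw.ne'
  refine HasDerivAt.deriv (h2.congr_deriv ?_)
  have hsq := Real.sq_sqrt h.le
  simp only [id]
  field_simp
  linear_combination hsq

lemma hasDerivAt_usub_time (R₀ : ℝ) {R : ℝ → ℝ} {R' x t : ℝ} (ht : 0 < t)
    (hR : HasDerivAt R R' t) (hQ : 0 < (rr t + R t) ^ 2 - R₀ ^ 2) (hw : 0 < rr t ^ 2 - x ^ 2) :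
    HasDerivAt (fun s => usub R₀ R x s)
      ((rr t + R t) * (3 / 4 * t ^ (-(1 / 4) : ℝ) + R') / √((rr t + R t) ^ 2 - R₀ ^ 2)
        - rr t * (3 / 4 * t ^ (-(1 / 4) : ℝ)) / √(rr t ^ 2 - x ^ 2)) t := by
  have hr := hasDerivAt_rr ht
  have h1 := (((hr.add hR).pow 2).sub_const (R₀ ^ 2)).sqrt hQ.ne'
  have h2 := ((hr.pow 2).sub_const (x ^ 2)).sqrt hw.ne'
  refine (h1.sub h2).congr_deriv ?_
  have := Real.sqrt_pos.2 hQ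
  have := Real.sqrt_pos.2 hw
  simp only [Pi.add_apply, Pi.pow_apply]
  field_simp
  norm_num
  ring

/-- The subsolution inequality follows from the dominance of `1 / r` over the remaining
positive terms. -/
lemma subsolution_of_dominated {r x Q B N A c : ℝ} (hx : |x| < r) (hQ : r < Q) (hA : 0 < A)
    (hN : 0 ≤ N) (hc : 0 ≤ c) (hB : r * (B + N / (Q - r)) < 1) :
    0 < Q - √(r ^ 2 - x ^ 2) ∧
    B - r * c / √(r ^ 2 - x ^ 2)
        - r ^ 2 / √(r ^ 2 - x ^ 2) ^ 3 / (1 + (x / √(r ^ 2 - x ^ 2)) ^ 2)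
        + N / (Q - √(r ^ 2 - x ^ 2))
        - A * √(1 + (x / √(r ^ 2 - x ^ 2)) ^ 2) < 0 := by
  have hr : 0 < r := (abs_nonneg x).trans_lt hx
  have h : 0 < r ^ 2 - x ^ 2 := sub_pos.2 (sq_lt_sq' (neg_lt_of_abs_lt hx) (lt_of_abs_lt hx))
  have hw := Real.sqrt_pos.2 h
  have hsq := Real.sq_sqrt h.le
  have hwr : √(r ^ 2 - x ^ 2) ≤ r := Real.sqrt_le_iff.2 ⟨hr.le, by nlinarith [sq_nonneg x]⟩
  generalize √(r ^ 2 - x ^ 2) = w at *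
  refine ⟨by linarith, ?_⟩
  have hcurv : r ^ 2 / w ^ 3 / (1 + (x / w) ^ 2) = 1 / w := by
    have e : 1 + (x / w) ^ 2 = r ^ 2 / w ^ 2 := by
      field_simp
      linarith
    rw [e]
    field_simp
  have h1 : N / (Q - w) ≤ N / (Q - r) :=
    div_le_div_of_nonneg_left hN (by linarith) (by linarith)
  have h2 : 1 / r ≤ 1 / w := one_div_le_one_div_of_le hw hwr
  have h3 : B + N / (Q - r) < 1 / r := by
    rw [lt_div_iff₀ hr]
    linarith
  have h4 : 0 ≤ r * c / w := by positivity
  have h5 : 0 ≤ A * √(1 + (x / w) ^ 2) := by positivity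
  rw [hcurv]
  linarith

lemma tendsto_sq_sub_sq_div_rr {R₀ R' : ℝ} {R : ℝ → ℝ} (hR0 : R 0 = R₀)
    (hR : HasDerivWithinAt R R' (Set.Ioi 0) 0) :
    Tendsto (fun t => ((rr t + R t) ^ 2 - R₀ ^ 2) / rr t) (𝓝[>] 0) (𝓝 (2 * R₀)) := by
  have hr : Tendsto rr (𝓝[>] 0) (𝓝 0) := tendsto_rpow_nhdsGT_zero (by norm_num)
  have hRc : Tendsto R (𝓝[>] 0) (𝓝 R₀) := hR0 ▸ hR.continuousWithinAt.tendsto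
  have hs : Tendsto (slope R 0) (𝓝[>] 0) (𝓝 R') :=
    (hasDerivWithinAt_iff_tendsto_slope' (by simp)).1 hR
  have ht := tendsto_rpow_nhdsGT_zero (a := 1 / 4) (by norm_num)
  have h := ((hr.add hRc).add_const R₀).mul ((hs.mul ht).const_add 1)
  have e : (0 + R₀ + R₀) * (1 + R' * 0) = 2 * R₀ := by ring
  rw [e] at h
  refine h.congr' ?_
  filter_upwards [self_mem_nhdsWithin] with t (ht : 0 < t)
  have hrp := rr_pos ht
  have hmul : t ^ (1 / 4 : ℝ) * rr t = t := by
    rw [rr, ← Real.rpow_add ht]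
    norm_num
  rw [slope_def_field, hR0, sub_zero, eq_div_iff hrp.ne']
  have h2 : (R t - R₀) / t * t = R t - R₀ := div_mul_cancel₀ _ ht.ne'
  linear_combination (rr t + R t + R₀) * ((R t - R₀) / t * hmul + h2)

/-- For small times `1 / r` dominates the positive terms of the evolution equation. -/
lemma eventually_dominated {R₀ N : ℝ} {R V : ℝ → ℝ} {R' : ℝ} (hR₀ : 0 < R₀) (hR0 : R 0 = R₀)
    (hR : HasDerivWithinAt R R' (Set.Ioi 0) 0) (hV : Tendsto V (𝓝[>] 0) (𝓝 R')) :
    ∀ᶠ t in 𝓝[>] (0 : ℝ), 0 < (rr t + R t) ^ 2 - R₀ ^ 2 ∧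
      rr t < √((rr t + R t) ^ 2 - R₀ ^ 2) ∧
      rr t * ((rr t + R t) * (3 / 4 * t ^ (-(1 / 4) : ℝ) + V t) / √((rr t + R t) ^ 2 - R₀ ^ 2)
        + N / (√((rr t + R t) ^ 2 - R₀ ^ 2) - rr t)) < 1 := by
  have hr : Tendsto rr (𝓝[>] 0) (𝓝 0) := tendsto_rpow_nhdsGT_zero (by norm_num)
  have hRc : Tendsto R (𝓝[>] 0) (𝓝 R₀) := hR0 ▸ hR.continuousWithinAt.tendsto
  have hp := tendsto_rpow_nhdsGT_zero (a := 3 / 8) (by norm_num)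
  have hq := tendsto_rpow_nhdsGT_zero (a := 1 / 8) (by norm_num)
  have hD := tendsto_sq_sub_sq_div_rr hR0 hR
  have hk := hD.sqrt.inv₀ (Real.sqrt_pos.2 (by positivity : 0 < 2 * R₀)).ne'
  have hpk := hp.mul hk
  have h1 := ((hr.add hRc).mul ((hq.const_mul (3 / 4)).add (hp.mul hV))).mul hk
  have h2 := (hpk.const_mul N).div (hpk.const_sub 1) (by simp)
  have h3 := h1.add h2
  simp only [Pi.div_apply, mul_zero, zero_mul, add_zero, zero_div] at h3 hpk
  filter_upwards [self_mem_nhdsWithin, hD.eventually (lt_mem_nhds (by positivity : 0 < 2 * R₀)),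
    hpk.eventually (gt_mem_nhds one_pos), h3.eventually (gt_mem_nhds one_pos)]
    with t (ht : 0 < t) hDt hpkt h3t
  have hrp := rr_pos ht
  have hpp : 0 < t ^ (3 / 8 : ℝ) := Real.rpow_pos_of_pos ht _
  have hrp2 : rr t = t ^ (3 / 8 : ℝ) * t ^ (3 / 8 : ℝ) := by
    rw [rr, ← Real.rpow_add ht]
    norm_num
  have hpq : t ^ (3 / 8 : ℝ) * t ^ (-(1 / 4) : ℝ) = t ^ (1 / 8 : ℝ) := by
    rw [← Real.rpow_add ht]
    norm_num
  have hpos : 0 < (rr t + R t) ^ 2 - R₀ ^ 2 := (div_pos_iff_of_pos_right hrp).1 hDt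
  have hQ := Real.sqrt_pos.2 hpos
  have hsr : √(rr t) = t ^ (3 / 8 : ℝ) := by rw [hrp2, Real.sqrt_mul_self hpp.le]
  rw [Real.sqrt_div hpos.le, hsr, inv_div] at hpkt h3t
  generalize √((rr t + R t) ^ 2 - R₀ ^ 2) = Q at *
  rw [← mul_div_assoc, ← hrp2, div_lt_one hQ] at hpkt
  have hQr : 0 < Q - rr t := sub_pos.2 hpkt
  refine ⟨hpos, hpkt, ?_⟩
  refine lt_of_eq_of_lt ?_ h3t
  rw [← mul_div_assoc (t ^ (3 / 8 : ℝ)), ← hrp2, one_sub_div hQ.ne', ← hpq, mul_add]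
  congr 1
  · rw [mul_div_assoc', mul_div_assoc']
    congr 1
    linear_combination
      (rr t + R t) * (3 / 4 * t ^ (-(1 / 4) : ℝ) + V t) * hrp2
  · field_simp

/-- with `R' = A − n/R`, `R(0) = R₀ > 0`, the function `usub` is a positive strict
sub-solution of the rotationally symmetric graph equation on
`{|x| < R₀·r(t)/(R(t)+r(t))}`, for small times `t`. -/
theorem subsolution_inner (n : ℕ) (hn : 2 ≤ n) (A R₀ δ : ℝ)
    (hA : 0 < A) (hR₀ : 0 < R₀) (hδ : 0 < δ) (R : ℝ → ℝ)
    (hRpos : ∀ t ∈ Set.Ico (0 : ℝ) δ, 0 < R t) (hR0 : R 0 = R₀)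
    (hR' : ∀ t ∈ Set.Ico (0 : ℝ) δ, HasDerivWithinAt R (A - (n : ℝ) / R t) (Set.Ico 0 δ) t) :
    ∃ tstar ∈ Set.Ioo (0 : ℝ) δ, ∀ t ∈ Set.Ioo (0 : ℝ) tstar, ∀ x : ℝ,
      |x| < R₀ * rr t / (R t + rr t) →
      0 < usub R₀ R x t ∧
      deriv (fun s => usub R₀ R x s) t
          - deriv (deriv (fun y => usub R₀ R y t)) x
              / (1 + (deriv (fun y => usub R₀ R y t) x) ^ 2)
          + ((n : ℝ) - 1) / usub R₀ R x t
          - A * Real.sqrt (1 + (deriv (fun y => usub R₀ R y t) x) ^ 2) < 0 := by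
  have hδ0 : (0 : ℝ) ∈ Set.Ico 0 δ := ⟨le_rfl, hδ⟩
  have hd0 : HasDerivWithinAt R (A - (n : ℝ) / R₀) (Set.Ioi 0) 0 := by
    have h := hR' 0 hδ0
    rw [hR0] at h
    exact h.mono_of_mem_nhdsWithin (Ico_mem_nhdsGT hδ)
  have hV : Tendsto (fun t => A - (n : ℝ) / R t) (𝓝[>] 0) (𝓝 (A - (n : ℝ) / R₀)) := by
    have hRc : Tendsto R (𝓝[>] 0) (𝓝 R₀) := hR0 ▸ hd0.continuousWithinAt.tendsto
    exact (tendsto_const_nhds.div hRc hR₀.ne').const_sub A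
  obtain ⟨τ, hτ, hsub⟩ := mem_nhdsGT_iff_exists_Ioo_subset.1
    (eventually_dominated (N := (n : ℝ) - 1) hR₀ hR0 hd0 hV)
  refine ⟨min τ (δ / 2), ⟨lt_min hτ (by linarith), (min_le_right _ _).trans_lt (by linarith)⟩, ?_⟩
  rintro t ⟨ht, htt⟩ x hx
  have htδ : t < δ := by linarith [htt.trans_le (min_le_right τ (δ / 2))]
  obtain ⟨hpos, hQ, hB⟩ := hsub ⟨ht, htt.trans_le (min_le_left _ _)⟩
  have hrp := rr_pos ht
  have hRt := hRpos t ⟨ht.le, htδ⟩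
  have hsum : R₀ < R t + rr t := lt_of_pow_lt_pow_left₀ 2 (by positivity) (by linarith)
  have hxr : |x| < rr t := by
    refine hx.trans ?_
    rw [div_lt_iff₀ (by positivity), mul_comm]
    gcongr
  have hw : 0 < rr t ^ 2 - x ^ 2 :=
    sub_pos.2 (sq_lt_sq' (neg_lt_of_abs_lt hxr) (lt_of_abs_lt hxr))
  have hRd := (hR' t ⟨ht.le, htδ⟩).hasDerivAt (Ico_mem_nhds ht htδ)
  rw [(hasDerivAt_usub_time R₀ ht hRd hpos hw).deriv, deriv_deriv_usub_space R₀ R hw,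
    (hasDerivAt_usub_space R₀ R hw).deriv]
  have hn' : (2 : ℝ) ≤ n := by exact_mod_cast hn
  exact subsolution_of_dominated hxr hQ hA (by linarith) (by positivity) hB
end

section
/- Let n ≥ 1, A > 0, T > 0, v₀ > 0, and let Ω_T = B₁(0) × (0, 2T) ⊂ ℝⁿ × ℝ. Suppose u ∈ C³(Ω_T) ∩ C⁰(closure of Ω_T) satisfies the quasilinear equation u_t = Σ_{i,j=1}^n (δ_{ij} − u_{x_i}u_{x_j}/(1 + |∇u|²))·u_{x_i x_j} + A·√(1 + |∇u|²) in Ω_T, with u < 0 throughout Ω_T and u(0, T) = −v₀. Then |∇u(0, T)| ≤ (3 + 16·v₀)·e^{2K}, where K = 20·v₀²·(4n + 1/T + 4A + A/(2v₀)) + 2. -/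
/-- Spatial partial derivative `∂u/∂xᵢ` of `u(·, t)` at `x`. -/
noncomputable def pd {n : ℕ} (u : EuclideanSpace ℝ (Fin n) → ℝ → ℝ) (t : ℝ)
    (x : EuclideanSpace ℝ (Fin n)) (i : Fin n) : ℝ :=
  fderiv ℝ (fun y => u y t) x (EuclideanSpace.single i 1)

/-- Spatial second partial derivative `∂²u/∂xᵢ∂xⱼ` of `u(·, t)` at `x`. -/
noncomputable def pd2 {n : ℕ} (u : EuclideanSpace ℝ (Fin n) → ℝ → ℝ) (t : ℝ)
    (x : EuclideanSpace ℝ (Fin n)) (i j : Fin n) : ℝ :=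
  fderiv ℝ (fun y => pd u t y j) x (EuclideanSpace.single i 1)

open Filter Topology

/-- Directional derivative of `F` along `a`. -/
noncomputable def dirD {W : Type*} [NormedAddCommGroup W] [NormedSpace ℝ W] (a : W) (F : W → ℝ)
    (z : W) : ℝ :=
  fderiv ℝ F z a

section Directional

variable {W : Type*} [NormedAddCommGroup W] [NormedSpace ℝ W] {F : W → ℝ} {O : Set W}

theorem ContDiffOn.dirD {m k : WithTop ℕ∞} (hO : IsOpen O) (hF : ContDiffOn ℝ k F O)
    (hmk : m + 1 ≤ k) (a : W) : ContDiffOn ℝ m (dirD a F) O :=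
  (hF.fderiv_of_isOpen hO hmk).clm_apply contDiffOn_const

theorem dirD_comm (hO : IsOpen O) (hF : ContDiffOn ℝ 2 F O) {z : W} (hz : z ∈ O) (a b : W) :
    dirD a (dirD b F) z = dirD b (dirD a F) z := by
  have hd : DifferentiableAt ℝ (fderiv ℝ F) z :=
    ((hF.fderiv_of_isOpen hO (m := 1) (by norm_num)).differentiableOn (by norm_num)).differentiableAt
      (hO.mem_nhds hz)
  have key : ∀ a b : W, dirD a (dirD b F) z = fderiv ℝ (fderiv ℝ F) z a b := by
    intro a b
    change fderiv ℝ (fun y => fderiv ℝ F y b) z a = _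
    rw [fderiv_clm_apply hd (differentiableAt_const b)]
    simp
  rw [key, key]
  exact ((hF.contDiffAt (hO.mem_nhds hz)).isSymmSndFDerivAt (by simp)).eq a b

theorem hasDerivAt_line {z a : W} {s : ℝ} (h : DifferentiableAt ℝ F (z + s • a)) :
    HasDerivAt (fun r : ℝ => F (z + r • a)) (dirD a F (z + s • a)) s := by
  have hl : HasDerivAt (fun r : ℝ => z + r • a) a s := by
    simpa using ((hasDerivAt_id s).smul_const a).const_add z
  exact h.hasFDerivAt.comp_hasDerivAt s hl

theorem dirD_congr_of_eventuallyEq {G : W → ℝ} {z : W} (h : F =ᶠ[𝓝 z] G) (a : W) :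
    dirD a F z = dirD a G z := by
  unfold dirD
  rw [h.fderiv_eq]

theorem dirD_sum_smul {ι : Type*} (s : Finset ι) (c : ι → ℝ) (e : ι → W) (z : W) :
    dirD (∑ i ∈ s, c i • e i) F z = ∑ i ∈ s, c i * dirD (e i) F z := by
  simp [dirD]

theorem dirD_dirD_sum_smul {ι : Type*} [Fintype ι] (hO : IsOpen O) (hF : ContDiffOn ℝ 2 F O)
    {z : W} (hz : z ∈ O) (c : ι → ℝ) (e : ι → W) :
    dirD (∑ i, c i • e i) (dirD (∑ i, c i • e i) F) z =
      ∑ i, ∑ j, c i * c j * dirD (e i) (dirD (e j) F) z := by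
  have h1 : dirD (∑ i, c i • e i) F = fun y => ∑ j, c j * dirD (e j) F y := by
    ext y
    exact dirD_sum_smul _ _ _ _
  have hd : ∀ j, DifferentiableAt ℝ (dirD (e j) F) z := fun j =>
    ((hF.dirD hO (m := 1) (by norm_num) (e j)).differentiableOn
      (by norm_num)).differentiableAt (hO.mem_nhds hz)
  rw [dirD_sum_smul]
  refine Finset.sum_congr rfl fun i _ => ?_
  rw [h1]
  have h2 : dirD (e i) (fun y => ∑ j, c j * dirD (e j) F y) z =
      ∑ j, c j * dirD (e i) (dirD (e j) F) z := by
    have : HasFDerivAt (fun y => ∑ j, c j * dirD (e j) F y)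
        (∑ j, c j • fderiv ℝ (dirD (e j) F) z) z :=
      HasFDerivAt.fun_sum fun j _ => (hd j).hasFDerivAt.const_mul (c j)
    rw [dirD, this.fderiv]
    simp [dirD]
  rw [h2, Finset.mul_sum]
  exact Finset.sum_congr rfl fun j _ => by ring

end Directional

/-- Second derivative test at a local maximum of a function of one variable. -/
theorem IsLocalMax.second_deriv_nonpos {g g' : ℝ → ℝ} {g'' a : ℝ} (h : IsLocalMax g a)
    (hg : ∀ᶠ s in 𝓝 a, HasDerivAt g (g' s) s) (hg' : HasDerivAt g' g'' a) : g'' ≤ 0 := by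
  by_contra! hpos
  have hd : deriv g =ᶠ[𝓝 a] g' := hg.mono fun s hs => hs.deriv
  have hdd : deriv (deriv g) a = g'' := by rw [hd.deriv_eq, hg'.deriv]
  have hmin := isLocalMin_of_deriv_deriv_pos (hdd ▸ hpos) h.deriv_eq_zero
    hg.self_of_nhds.continuousAt
  have hconst : g =ᶠ[𝓝 a] fun _ => g a := by
    filter_upwards [h, hmin] with s h1 h2 using le_antisymm h1 h2
  have : deriv (deriv g) a = 0 := by
    rw [hconst.deriv.deriv_eq]
    simp
  linarith

/-- A nonpositive quadratic form has nonpositive contraction with `δᵢⱼ - pᵢ pⱼ / (1 + |p|²)`. -/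
theorem contraction_nonpos {n : ℕ} (p : Fin n → ℝ) (Z : Fin n → Fin n → ℝ)
    (hZ : ∀ b : Fin n → ℝ, ∑ i, ∑ j, b i * b j * Z i j ≤ 0) :
    ∑ i, ∑ j, ((if i = j then (1 : ℝ) else 0) - p i * p j / (1 + ∑ k, p k ^ 2)) * Z i j ≤ 0 := by
  set P := 1 + ∑ k, p k ^ 2 with hP
  have hP1 : 1 ≤ P := by
    have : 0 ≤ ∑ k, p k ^ 2 := Finset.sum_nonneg fun _ _ => sq_nonneg _
    linarith
  set v := Real.sqrt P
  have hv : 0 < v := Real.sqrt_pos.2 (by linarith)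
  have hv2 : v ^ 2 = P := Real.sq_sqrt (by linarith)
  set c := 1 / (v * (v + 1)) with hc
  have hcP : 2 * c - c ^ 2 * (P - 1) = 1 / P := by
    rw [← hv2, hc]
    field_simp
    ring
  have hsum : ∀ i j, ∑ m, ((if m = i then (1 : ℝ) else 0) - c * p m * p i) *
      ((if m = j then (1 : ℝ) else 0) - c * p m * p j) =
      (if i = j then (1 : ℝ) else 0) - p i * p j / P := by
    intro i j
    have h1 : ∀ m, ((if m = i then (1 : ℝ) else 0) - c * p m * p i) *
      ((if m = j then (1 : ℝ) else 0) - c * p m * p j) =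
        (if m = i then (if m = j then (1 : ℝ) else 0) else 0)
        - (if m = i then c * p m * p j else 0) - (if m = j then c * p m * p i else 0)
        + c ^ 2 * p i * p j * p m ^ 2 := by
      intro m
      split_ifs <;> ring
    simp only [h1, Finset.sum_add_distrib, Finset.sum_sub_distrib, Finset.sum_ite_eq',
      Finset.mem_univ, if_true, ← Finset.mul_sum]
    have : ∑ k, p k ^ 2 = P - 1 := by rw [hP]; ring
    rw [this, div_eq_mul_one_div, ← hcP]
    ring
  have : ∑ i, ∑ j, ((if i = j then (1 : ℝ) else 0) - p i * p j / P) * Z i j =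
      ∑ m, ∑ i, ∑ j, ((if m = i then (1 : ℝ) else 0) - c * p m * p i) *
      ((if m = j then (1 : ℝ) else 0) - c * p m * p j) * Z i j := by
    rw [Finset.sum_comm]
    simp only [← hsum, Finset.sum_mul]
    rw [Finset.sum_comm]
    conv_rhs => rw [Finset.sum_comm]
    refine Finset.sum_congr rfl fun i _ => ?_
    rw [Finset.sum_comm]
  rw [this]
  exact Finset.sum_nonpos fun m _ => hZ _

/-- First and second order conditions at a local maximum of `(exp (K φ) - 1)² (1 + |w|²)`
along a line. -/
theorem line_max_conditions {n : ℕ} {K : ℝ} {φ φ' : ℝ → ℝ} {φ'' : ℝ} {w w' : Fin n → ℝ → ℝ}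
    {w'' : Fin n → ℝ} (hK : 0 < K) (hpos : 0 < φ 0)
    (hφ : ∀ᶠ s in 𝓝 0, HasDerivAt φ (φ' s) s) (hφ' : HasDerivAt φ' φ'' 0)
    (hw : ∀ k, ∀ᶠ s in 𝓝 0, HasDerivAt (w k) (w' k s) s)
    (hw' : ∀ k, HasDerivAt (w' k) (w'' k) 0)
    (hmax : IsLocalMax (fun s => (Real.exp (K * φ s) - 1) ^ 2 * (1 + ∑ k, w k s ^ 2)) 0) {l P : ℝ}
    (hl : l = K * Real.exp (K * φ 0) / (Real.exp (K * φ 0) - 1)) (hP : P = 1 + ∑ k, w k 0 ^ 2) :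
    l * φ' 0 * P + ∑ k, w k 0 * w' k 0 = 0 ∧
      ∑ k, w k 0 * w'' k ≤ P * (2 * l ^ 2 * φ' 0 ^ 2 - l * φ'' - K * l * φ' 0 ^ 2) := by
  have hPge : ∀ s, 1 ≤ 1 + ∑ k, w k s ^ 2 := fun s => by
    have : 0 ≤ ∑ k, w k s ^ 2 := Finset.sum_nonneg fun _ _ => sq_nonneg _
    linarith
  have hP0 : 0 < P := by linarith [hPge 0]
  have hE : ∀ {s}, 0 < φ s → 0 < Real.exp (K * φ s) - 1 := fun h => by
    have := Real.add_one_lt_exp (mul_pos hK h).ne'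
    nlinarith [mul_pos hK h]
  have hevpos : ∀ᶠ s in 𝓝 0, 0 < φ s :=
    hφ.self_of_nhds.continuousAt.eventually_mem (Ioi_mem_nhds hpos)
  set g : ℝ → ℝ := fun s => 2 * Real.log (Real.exp (K * φ s) - 1) +
    Real.log (1 + ∑ k, w k s ^ 2) with hg
  have hgmax : IsLocalMax g 0 := by
    filter_upwards [hmax, hevpos] with s hs hs0
    have h1 : ∀ r, 0 < φ r → g r =
        Real.log ((Real.exp (K * φ r) - 1) ^ 2 * (1 + ∑ k, w k r ^ 2)) := by
      intro r hr
      rw [Real.log_mul (pow_pos (hE hr) 2).ne' (by linarith [hPge r]), Real.log_pow]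
      simp [hg]
    rw [h1 s hs0, h1 0 hpos]
    exact Real.log_le_log (mul_pos (pow_pos (hE hs0) 2) (by linarith [hPge s])) hs
  have hS : ∀ s, (∀ k, HasDerivAt (w k) (w' k s) s) →
      HasDerivAt (fun s => 1 + ∑ k, w k s ^ 2) (∑ k, 2 * w k s * w' k s) s := by
    intro s h
    refine HasDerivAt.const_add 1 (HasDerivAt.fun_sum fun k _ => ?_)
    simpa using (h k).fun_pow 2
  have hL : ∀ s, HasDerivAt φ (φ' s) s →
      HasDerivAt (fun s => Real.exp (K * φ s)) (Real.exp (K * φ s) * (K * φ' s)) s :=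
    fun s h => (h.const_mul K).exp
  have hg1 : ∀ᶠ s in 𝓝 0, HasDerivAt g (2 * (Real.exp (K * φ s) * (K * φ' s) /
      (Real.exp (K * φ s) - 1)) + (∑ k, 2 * w k s * w' k s) / (1 + ∑ k, w k s ^ 2)) s := by
    filter_upwards [hevpos, hφ, eventually_all.2 hw] with s h0 h1 h2
    exact ((((hL s h1).sub_const 1).log (hE h0).ne').const_mul 2).add
      ((hS s h2).log (by linarith [hPge s]))
  have hφ0 := hφ.self_of_nhds
  have hw0 : ∀ k, HasDerivAt (w k) (w' k 0) 0 := fun k => (hw k).self_of_nhds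
  have hg2 := (((((hL 0 hφ0).fun_mul (hφ'.const_mul K)).fun_div ((hL 0 hφ0).sub_const 1)
    (hE hpos).ne').const_mul 2).fun_add
    ((HasDerivAt.fun_sum (u := Finset.univ) fun k _ => ((hw0 k).const_mul 2).fun_mul (hw' k)).fun_div
      (hS 0 hw0) (by linarith [hPge 0])))
  have c1 := hgmax.hasDerivAt_eq_zero hg1.self_of_nhds
  have c2 := hgmax.second_deriv_nonpos hg1 hg2
  rw [← hP] at c1 c2
  have hE0 := hE hpos
  set E := Real.exp (K * φ 0)
  have hEl : E = l * (E - 1) / K := by rw [hl]; field_simp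
  set q := ∑ k, w k 0 * w' k 0 with hq
  have hq2 : ∑ k, 2 * w k 0 * w' k 0 = 2 * q := by
    rw [hq, Finset.mul_sum]; exact Finset.sum_congr rfl fun k _ => by ring
  have hr : ∑ k, (2 * w' k 0 * w' k 0 + 2 * w k 0 * w'' k) =
      2 * ∑ k, w' k 0 ^ 2 + 2 * ∑ k, w k 0 * w'' k := by
    rw [Finset.sum_add_distrib, Finset.mul_sum, Finset.mul_sum]
    congr 1 <;> exact Finset.sum_congr rfl fun k _ => by ring
  have hcs : q ^ 2 ≤ P * ∑ k, w' k 0 ^ 2 := by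
    have h1 := Finset.sum_mul_sq_le_sq_mul_sq Finset.univ (fun k => w k 0) (fun k => w' k 0)
    have h2 : 0 ≤ ∑ k, w' k 0 ^ 2 := Finset.sum_nonneg fun _ _ => sq_nonneg _
    rw [hP]
    nlinarith
  rw [hq2] at c1 c2
  rw [hr] at c2
  set R := ∑ k, w' k 0 ^ 2
  set Q := ∑ k, w k 0 * w'' k
  have e1 : E * (K * φ' 0) / (E - 1) = l * φ' 0 := by rw [hl]; ring
  have d1 : l * φ' 0 * P + q = 0 := by
    rw [e1] at c1
    field_simp at c1
    linarith
  refine ⟨d1, ?_⟩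
  have e2 : ((E * (K * φ' 0) * (K * φ' 0) + E * (K * φ'')) * (E - 1) -
      E * (K * φ' 0) * (E * (K * φ' 0))) / (E - 1) ^ 2 =
      K * l * φ' 0 ^ 2 + l * φ'' - l ^ 2 * φ' 0 ^ 2 := by
    rw [hl]
    field_simp
  rw [e2] at c2
  have hqe : q = -(l * φ' 0 * P) := by linarith
  have c3 : 2 * (K * l * φ' 0 ^ 2 + l * φ'' - l ^ 2 * φ' 0 ^ 2) * P ^ 2 +
      ((2 * R + 2 * Q) * P - 2 * q * (2 * q)) ≤ 0 := by
    have := mul_le_mul_of_nonneg_right c2 (sq_nonneg P)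
    rw [add_mul, div_mul_cancel₀ _ (pow_ne_zero 2 hP0.ne')] at this
    linarith
  rw [hqe] at c3 hcs
  have : P * Q ≤ P * (P * (2 * l ^ 2 * φ' 0 ^ 2 - l * φ'' - K * l * φ' 0 ^ 2)) := by
    nlinarith
  exact le_of_mul_le_mul_left this hP0

/-- The differential inequality for `φ` at a maximum of `(exp (K φ) - 1)² (1 + |∇u|²)`, where
`M` is the contraction of the third derivatives with the gradient `p`. -/
theorem cutoff_inequality {n : ℕ} {A K l q φt P : ℝ} {p Φ r : Fin n → ℝ}
    {H M Ψ : Fin n → Fin n → ℝ}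
    (hl : 0 < l) (hP : P = 1 + ∑ k, p k ^ 2) (hH : ∀ i j, H i j = H j i)
    (hr : ∀ i, r i = ∑ k, p k * H k i)
    (hfirst : ∀ i, l * Φ i * P + r i = 0)
    (hsecond : ∀ b : Fin n → ℝ, ∑ i, ∑ j, b i * b j *
      (M i j - P * ((2 * l ^ 2 - K * l) * (Φ i * Φ j) - l * Ψ i j)) ≤ 0)
    (htime : 0 ≤ l * φt * P + q)
    (heq : q = ∑ i, ∑ j, (-((r i * p j + p i * r j) * P - p i * p j * ∑ k, 2 * p k * r k) / P ^ 2 *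
        H i j + ((if i = j then (1 : ℝ) else 0) - p i * p j / P) * M i j) +
        A * ((∑ k, 2 * p k * r k) / (2 * Real.sqrt P))) :
    K * ∑ i, ∑ j, ((if i = j then (1 : ℝ) else 0) - p i * p j / P) * (Φ i * Φ j) ≤
      φt - ∑ i, ∑ j, ((if i = j then (1 : ℝ) else 0) - p i * p j / P) * Ψ i j -
        A / Real.sqrt P * ∑ k, p k * Φ k := by
  have hP0 : 0 < P := by
    have : 0 ≤ ∑ k, p k ^ 2 := Finset.sum_nonneg fun _ _ => sq_nonneg _
    linarith
  have hv : 0 < Real.sqrt P := Real.sqrt_pos.2 hP0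
  have hcon := contraction_nonpos p _ hsecond
  rw [← hP] at hcon
  simp only [Finset.sum_add_distrib] at heq
  set a : Fin n → Fin n → ℝ := fun i j => (if i = j then (1 : ℝ) else 0) - p i * p j / P with ha
  change K * ∑ i, ∑ j, a i j * (Φ i * Φ j) ≤ φt - ∑ i, ∑ j, a i j * Ψ i j - _
  change ∑ i, ∑ j, a i j * _ ≤ 0 at hcon
  have hcon' : ∑ i, ∑ j, a i j * M i j ≤ P * ((2 * l ^ 2 - K * l) *
      ∑ i, ∑ j, a i j * (Φ i * Φ j) - l * ∑ i, ∑ j, a i j * Ψ i j) := by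
    refine le_of_sub_nonpos (le_trans (le_of_eq ?_) hcon)
    simp only [Finset.mul_sum, ← Finset.sum_sub_distrib]
    exact Finset.sum_congr rfl fun i _ => Finset.sum_congr rfl fun j _ => by ring
  have hrΦ : ∀ i, r i = -(l * P) * Φ i := fun i => by linarith [hfirst i]
  set y := ∑ k, p k * Φ k with hy
  have hs : ∑ k, 2 * p k * r k = -(2 * l * P) * y := by
    rw [hy, Finset.mul_sum]
    exact Finset.sum_congr rfl fun k _ => by rw [hrΦ]; ring
  have ht1 : ∑ i, ∑ j, r i * p j * H i j = (l * P) ^ 2 * ∑ i, Φ i ^ 2 := by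
    rw [Finset.mul_sum]
    refine Finset.sum_congr rfl fun i _ => ?_
    have : ∑ j, r i * p j * H i j = r i * r i := by
      calc ∑ j, r i * p j * H i j = r i * ∑ j, p j * H j i := by
            rw [Finset.mul_sum]
            exact Finset.sum_congr rfl fun j _ => by rw [hH i j]; ring
        _ = r i * r i := by rw [← hr i]
    rw [this, hrΦ]; ring
  have ht2 : ∑ i, ∑ j, p i * r j * H i j = (l * P) ^ 2 * ∑ i, Φ i ^ 2 := by
    rw [← ht1, Finset.sum_comm]
    exact Finset.sum_congr rfl fun i _ => Finset.sum_congr rfl fun j _ => by rw [hH i j]; ring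
  have ht3 : ∑ i, ∑ j, p i * p j * H i j = -(l * P) * y := by
    rw [hy, Finset.mul_sum, Finset.sum_comm]
    refine Finset.sum_congr rfl fun j _ => ?_
    have : ∑ i, p i * p j * H i j = p j * r j := by
      rw [hr j, Finset.mul_sum]
      exact Finset.sum_congr rfl fun i _ => by ring
    rw [this, hrΦ]; ring
  have haa : ∑ i, ∑ j, a i j * (Φ i * Φ j) = ∑ i, Φ i ^ 2 - y ^ 2 / P := by
    have : ∀ i j, a i j * (Φ i * Φ j) =
        (if i = j then Φ i * Φ j else 0) - (p i * Φ i) * (p j * Φ j) / P := by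
      intro i j
      simp only [ha]
      split_ifs <;> ring
    simp only [this, Finset.sum_sub_distrib, Finset.sum_ite_eq, Finset.mem_univ, if_true,
      ← Finset.sum_div, ← Finset.mul_sum, ← Finset.sum_mul, ← hy]
    simp only [pow_two]
  have hda : ∑ i, ∑ j, -((r i * p j + p i * r j) * P - p i * p j * ∑ k, 2 * p k * r k) / P ^ 2 *
      H i j = -(2 * l ^ 2 * P) * ∑ i, ∑ j, a i j * (Φ i * Φ j) := by
    have h1 : ∀ i j, -((r i * p j + p i * r j) * P - p i * p j * ∑ k, 2 * p k * r k) / P ^ 2 *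
        H i j = -(1 / P) * (r i * p j * H i j) + -(1 / P) * (p i * r j * H i j) +
          (∑ k, 2 * p k * r k) / P ^ 2 * (p i * p j * H i j) := by
      intro i j
      field_simp
      ring
    simp only [h1, Finset.sum_add_distrib, ← Finset.mul_sum]
    rw [ht1, ht2, ht3, hs, haa]
    field_simp
    ring
  rw [hda, hs] at heq
  set X := ∑ i, ∑ j, a i j * (Φ i * Φ j)
  set Y := ∑ i, ∑ j, a i j * Ψ i j
  have hA : A * (-(2 * l * P) * y / (2 * Real.sqrt P)) = -(l * P) * (A / Real.sqrt P * y) := by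
    field_simp
  rw [hA] at heq
  have : 0 ≤ (l * P) * (φt - Y - A / Real.sqrt P * y - K * X) := by
    change q = _ + ∑ i, ∑ j, a i j * M i j + _ at heq
    nlinarith
  have := nonneg_of_mul_nonneg_right this (mul_pos hl hP0)
  linarith

set_option maxHeartbeats 400000 in
theorem sqrt_lt_of_cutoff_inequality {n : ℕ} {A T v₀ τ P ut φt : ℝ} {p x Φ : Fin n → ℝ}
    {H Ψ : Fin n → Fin n → ℝ} (hA : 0 < A) (hT : 0 < T) (hv₀ : 0 < v₀) (hτ0 : 0 ≤ τ) (hτ1 : τ ≤ 1)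
    (hx : ∑ i, x i ^ 2 ≤ 1) (hP : P = 1 + ∑ k, p k ^ 2)
    (hΦ : ∀ i, Φ i = p i / (2 * v₀) - τ * (2 * x i))
    (hΨ : ∀ i j, Ψ i j = H i j / (2 * v₀) - τ * (if i = j then 2 else 0))
    (hφt : φt = ut / (2 * v₀) + (1 - ∑ i, x i ^ 2) / T)
    (hut : ut = ∑ i, ∑ j, ((if i = j then (1 : ℝ) else 0) - p i * p j / P) * H i j +
      A * Real.sqrt P)
    (h : (20 * v₀ ^ 2 * (4 * (n : ℝ) + 1 / T + 4 * A + A / (2 * v₀)) + 2) *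
      ∑ i, ∑ j, ((if i = j then (1 : ℝ) else 0) - p i * p j / P) * (Φ i * Φ j) ≤
      φt - ∑ i, ∑ j, ((if i = j then (1 : ℝ) else 0) - p i * p j / P) * Ψ i j -
        A / Real.sqrt P * ∑ k, p k * Φ k) :
    Real.sqrt P < 3 + 16 * v₀ := by
  by_contra! hbig
  have hq0 : 0 ≤ ∑ k, p k ^ 2 := Finset.sum_nonneg fun _ _ => sq_nonneg _
  have hX0 : 0 ≤ ∑ i, x i ^ 2 := Finset.sum_nonneg fun _ _ => sq_nonneg _
  have hcs := Finset.sum_mul_sq_le_sq_mul_sq Finset.univ p x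
  set v := Real.sqrt P with hv
  have hP0 : 0 < P := by linarith
  have hv0 : 0 < v := Real.sqrt_pos.2 hP0
  have hv2 : v ^ 2 = P := Real.sq_sqrt hP0.le
  set X := ∑ i, x i ^ 2 with hX
  set y := ∑ i, p i * x i with hy
  have hq : ∑ k, p k ^ 2 = v ^ 2 - 1 := by rw [hv2, hP]; ring
  have hpΦ : ∑ k, p k * Φ k = (v ^ 2 - 1) / (2 * v₀) - 2 * τ * y := by
    rw [← hq, hy, Finset.mul_sum, Finset.sum_div, ← Finset.sum_sub_distrib]
    exact Finset.sum_congr rfl fun k _ => by rw [hΦ]; ring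
  have hΦΦ : ∑ k, Φ k ^ 2 = (v ^ 2 - 1) / (4 * v₀ ^ 2) - 2 * τ * y / v₀ + 4 * τ ^ 2 * X := by
    have : ∀ k, Φ k ^ 2 = p k ^ 2 / (4 * v₀ ^ 2) - 2 * τ / v₀ * (p k * x k) +
        4 * τ ^ 2 * x k ^ 2 := by
      intro k
      rw [hΦ]
      field_simp
      ring
    simp only [this, Finset.sum_add_distrib, Finset.sum_sub_distrib, ← Finset.mul_sum,
      ← Finset.sum_div, hq, ← hX, ← hy]
    ring
  have haa : ∑ i, ∑ j, ((if i = j then (1 : ℝ) else 0) - p i * p j / P) * (Φ i * Φ j) =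
      ∑ i, Φ i ^ 2 - (∑ k, p k * Φ k) ^ 2 / P := by
    have : ∀ i j, ((if i = j then (1 : ℝ) else 0) - p i * p j / P) * (Φ i * Φ j) =
        (if i = j then Φ i * Φ j else 0) - (p i * Φ i) * (p j * Φ j) / P := by
      intro i j
      split_ifs <;> ring
    simp only [this, Finset.sum_sub_distrib, Finset.sum_ite_eq, Finset.mem_univ, if_true,
      ← Finset.sum_div, ← Finset.mul_sum, ← Finset.sum_mul]
    simp only [pow_two]
  have haΨ : ∑ i, ∑ j, ((if i = j then (1 : ℝ) else 0) - p i * p j / P) * Ψ i j =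
      (∑ i, ∑ j, ((if i = j then (1 : ℝ) else 0) - p i * p j / P) * H i j) / (2 * v₀) -
        2 * τ * (n - (v ^ 2 - 1) / P) := by
    have : ∀ i j, ((if i = j then (1 : ℝ) else 0) - p i * p j / P) * Ψ i j =
        ((if i = j then (1 : ℝ) else 0) - p i * p j / P) * H i j / (2 * v₀) -
        (if i = j then 2 * τ * (1 - p i ^ 2 / P) else 0) := by
      intro i j
      rw [hΨ]
      split_ifs with hij
      · subst hij; ring
      · ring
    simp only [this, Finset.sum_sub_distrib, Finset.sum_ite_eq, Finset.mem_univ, if_true,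
      ← Finset.sum_div, ← Finset.mul_sum, hq]
    simp
  have hyv : |y| ≤ v := by
    refine abs_le_of_sq_le_sq ?_ hv0.le
    rw [hq] at hcs
    nlinarith
  have hyX : y ^ 2 ≤ v ^ 2 * X := by
    rw [hq] at hcs
    nlinarith
  obtain ⟨hy1, hy2⟩ := abs_le.1 hyv
  rw [haa, haΨ, hφt, hut, hΦΦ, hpΦ, ← hv2] at h
  have hlow : 1 / (20 * v₀ ^ 2) ≤ (v ^ 2 - 1) / (4 * v₀ ^ 2) - 2 * τ * y / v₀ + 4 * τ ^ 2 * X -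
      ((v ^ 2 - 1) / (2 * v₀) - 2 * τ * y) ^ 2 / v ^ 2 := by
    have e : (v ^ 2 - 1) / (4 * v₀ ^ 2) - 2 * τ * y / v₀ + 4 * τ ^ 2 * X -
      ((v ^ 2 - 1) / (2 * v₀) - 2 * τ * y) ^ 2 / v ^ 2 =
      ((v ^ 2 - 1) / 4 - 2 * τ * y * v₀ + 4 * τ ^ 2 * v₀ ^ 2 * (v ^ 2 * X - y ^ 2)) /
        (v₀ ^ 2 * v ^ 2) := by
      field_simp
      ring
    rw [e, div_le_div_iff₀ (by positivity) (by positivity)]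
    have h1 : 0 ≤ 4 * τ ^ 2 * v₀ ^ 2 * (v ^ 2 * X - y ^ 2) :=
      mul_nonneg (by positivity) (by linarith)
    have h2 : τ * y ≤ v :=
      (mul_le_mul_of_nonneg_left hy2 hτ0).trans (mul_le_of_le_one_left hv0.le hτ1)
    have h3 : v₀ * v ≤ (v - 3) / 16 * v := mul_le_mul_of_nonneg_right (by linarith) hv0.le
    have h4 : τ * y * v₀ ≤ v * v₀ := mul_le_mul_of_nonneg_right h2 hv₀.le
    have h5 : 3 * v ≤ v ^ 2 := by nlinarith only [hbig, hv0, hv₀]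
    have h6 : v ^ 2 / 20 ≤ (v ^ 2 - 1) / 4 - 2 * τ * y * v₀ +
        4 * τ ^ 2 * v₀ ^ 2 * (v ^ 2 * X - y ^ 2) := by linarith
    have h7 := mul_le_mul_of_nonneg_right h6 (show 0 ≤ 20 * v₀ ^ 2 by positivity)
    linarith
  set S := ∑ i, ∑ j, ((if i = j then (1 : ℝ) else 0) - p i * p j / v ^ 2) * H i j
  have hup : (S + A * v) / (2 * v₀) + (1 - X) / T - (S / (2 * v₀) -
      2 * τ * (n - (v ^ 2 - 1) / v ^ 2)) - A / v * ((v ^ 2 - 1) / (2 * v₀) - 2 * τ * y) ≤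
      A / (2 * v₀) + 1 / T + 2 * n + 2 * A := by
    have e : (S + A * v) / (2 * v₀) + (1 - X) / T - (S / (2 * v₀) -
      2 * τ * (n - (v ^ 2 - 1) / v ^ 2)) - A / v * ((v ^ 2 - 1) / (2 * v₀) - 2 * τ * y) =
      A / (2 * v₀) * (1 / v) + 1 / T - X / T + 2 * (τ * n) - 2 * τ * ((v ^ 2 - 1) / v ^ 2) +
        2 * A * (τ * (y / v)) := by
      field_simp
      ring
    rw [e]
    have h1 : A / (2 * v₀) * (1 / v) ≤ A / (2 * v₀) := by
      refine mul_le_of_le_one_right (by positivity) ?_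
      rw [div_le_one hv0]
      linarith
    have h2 : 0 ≤ X / T := by positivity
    have h3 : τ * n ≤ n := mul_le_of_le_one_left (Nat.cast_nonneg n) hτ1
    have h4 : 0 ≤ 2 * τ * ((v ^ 2 - 1) / v ^ 2) := by
      rw [← hq]; positivity
    have h5 : τ * (y / v) ≤ 1 := by
      have : y / v ≤ 1 := by rw [div_le_one hv0]; exact hy2
      exact (mul_le_mul_of_nonneg_left this hτ0).trans (by linarith)
    have h6 := mul_le_mul_of_nonneg_left h5 (show 0 ≤ 2 * A by positivity)
    linarith
  have hK : 0 ≤ 20 * v₀ ^ 2 * (4 * (n : ℝ) + 1 / T + 4 * A + A / (2 * v₀)) + 2 := by positivity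
  have hfin := (mul_le_mul_of_nonneg_left hlow hK).trans (h.trans hup)
  have e : (20 * v₀ ^ 2 * (4 * (n : ℝ) + 1 / T + 4 * A + A / (2 * v₀)) + 2) *
      (1 / (20 * v₀ ^ 2)) = 4 * (n : ℝ) + 1 / T + 4 * A + A / (2 * v₀) + 2 / (20 * v₀ ^ 2) := by
    field_simp
  rw [e] at hfin
  have : 0 < 2 / (20 * v₀ ^ 2) := by positivity
  have : (0 : ℝ) ≤ n := Nat.cast_nonneg n
  linarith

section SpaceTime

variable {n : ℕ} {U : EuclideanSpace ℝ (Fin n) × ℝ → ℝ} {O : Set (EuclideanSpace ℝ (Fin n) × ℝ)}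

/-- The `i`-th spatial coordinate direction in space-time. -/
noncomputable def spaceDir (i : Fin n) : EuclideanSpace ℝ (Fin n) × ℝ :=
  (EuclideanSpace.single i 1, 0)

/-- The time direction in space-time. -/
def timeDir (n : ℕ) : EuclideanSpace ℝ (Fin n) × ℝ :=
  (0, 1)

theorem fderiv_slice {F : EuclideanSpace ℝ (Fin n) × ℝ → ℝ} {x : EuclideanSpace ℝ (Fin n)} {t : ℝ}
    (h : DifferentiableAt ℝ F (x, t)) (i : Fin n) :
    fderiv ℝ (fun y => F (y, t)) x (EuclideanSpace.single i 1) = dirD (spaceDir i) F (x, t) := by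
  have := (HasFDerivAt.comp (𝕜 := ℝ) (g := F) x h.hasFDerivAt
    (hasFDerivAt_prodMk_left x t)).fderiv
  simp only [Function.comp_def] at this
  rw [this]
  simp [dirD, spaceDir]

theorem deriv_slice {F : EuclideanSpace ℝ (Fin n) × ℝ → ℝ} {x : EuclideanSpace ℝ (Fin n)} {t : ℝ}
    (h : DifferentiableAt ℝ F (x, t)) :
    deriv (fun s => F (x, s)) t = dirD (timeDir n) F (x, t) := by
  have := (HasFDerivAt.comp (𝕜 := ℝ) (g := F) t h.hasFDerivAt
    (hasFDerivAt_prodMk_right x t)).fderiv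
  simp only [Function.comp_def] at this
  rw [← fderiv_apply_one_eq_deriv, this]
  simp [dirD, timeDir]

theorem sum_smul_spaceDir (b : Fin n → ℝ) :
    ∑ i, b i • spaceDir i = ((WithLp.toLp 2 b, 0) : EuclideanSpace ℝ (Fin n) × ℝ) := by
  refine Prod.ext ?_ ?_
  · ext j
    simp [spaceDir, Prod.fst_sum, Finset.sum_apply, Pi.single_apply]
  · simp [spaceDir, Prod.snd_sum]

/-- The function `u / (2 v₀) + (t / T) (1 - |x|²) - 1 / 4`. -/
noncomputable def cutoff (U : EuclideanSpace ℝ (Fin n) × ℝ → ℝ) (v₀ T : ℝ)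
    (z : EuclideanSpace ℝ (Fin n) × ℝ) : ℝ :=
  U z / (2 * v₀) + z.2 / T * (1 - ∑ i, z.1 i ^ 2) - 1 / 4

/-- The test function `(exp (K φ) - 1)² (1 + |∇u|²)`. -/
noncomputable def testFun (U : EuclideanSpace ℝ (Fin n) × ℝ → ℝ) (v₀ T K : ℝ)
    (z : EuclideanSpace ℝ (Fin n) × ℝ) : ℝ :=
  (Real.exp (K * cutoff U v₀ T z) - 1) ^ 2 * (1 + ∑ k, dirD (spaceDir k) U z ^ 2)

theorem eventually_hasDerivAt_line {F : EuclideanSpace ℝ (Fin n) × ℝ → ℝ} (hO : IsOpen O)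
    (hF : ContDiffOn ℝ 1 F O) {z : EuclideanSpace ℝ (Fin n) × ℝ} (hz : z ∈ O)
    (a : EuclideanSpace ℝ (Fin n) × ℝ) :
    ∀ᶠ s : ℝ in 𝓝 0, HasDerivAt (fun r : ℝ => F (z + r • a)) (dirD a F (z + s • a)) s := by
  have hc : ContinuousAt (fun s : ℝ => z + s • a) 0 := by fun_prop
  have : ∀ᶠ s : ℝ in 𝓝 0, z + s • a ∈ O :=
    hc.eventually_mem (by simpa using hO.mem_nhds hz)
  filter_upwards [this] with s hs
  exact hasDerivAt_line ((hF.differentiableOn (by norm_num)).differentiableAt (hO.mem_nhds hs))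

/-- First and second order spatial conditions at a maximum of the test function. -/
theorem testFun_space_conditions (hO : IsOpen O) (hU : ContDiffOn ℝ 3 U O)
    {v₀ T K : ℝ} (hK : 0 < K) {z : EuclideanSpace ℝ (Fin n) × ℝ} (hz : z ∈ O)
    (hpos : 0 < cutoff U v₀ T z)
    (hmax : IsLocalMaxOn (testFun U v₀ T K) {y | y.2 ≤ z.2} z) {l P : ℝ}
    (hl : l = K * Real.exp (K * cutoff U v₀ T z) / (Real.exp (K * cutoff U v₀ T z) - 1))
    (hP : P = 1 + ∑ k, dirD (spaceDir k) U z ^ 2) (b : Fin n → ℝ) :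
    l * (∑ i, b i * (dirD (spaceDir i) U z / (2 * v₀) - z.2 / T * (2 * z.1 i))) * P +
        ∑ k, dirD (spaceDir k) U z * ∑ i, b i * dirD (spaceDir i) (dirD (spaceDir k) U) z = 0 ∧
      ∑ k, dirD (spaceDir k) U z *
          ∑ i, ∑ j, b i * b j * dirD (spaceDir i) (dirD (spaceDir j) (dirD (spaceDir k) U)) z ≤
        P * (2 * l ^ 2 *
            (∑ i, b i * (dirD (spaceDir i) U z / (2 * v₀) - z.2 / T * (2 * z.1 i))) ^ 2 -
          l * (∑ i, ∑ j, b i * b j * (dirD (spaceDir i) (dirD (spaceDir j) U) z / (2 * v₀) -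
            z.2 / T * (if i = j then 2 else 0))) -
          K * l * (∑ i, b i * (dirD (spaceDir i) U z / (2 * v₀) - z.2 / T * (2 * z.1 i))) ^ 2) := by
  set a : EuclideanSpace ℝ (Fin n) × ℝ := ∑ i, b i • spaceDir i with ha
  have ha' := sum_smul_spaceDir b
  rw [← ha] at ha'
  have hfst : ∀ (s : ℝ) i, (z + s • a).1 i = z.1 i + s * b i := fun s i => by simp [ha']
  have hsnd : ∀ s : ℝ, (z + s • a).2 = z.2 := fun s => by simp [ha']
  have hUk : ∀ k, ContDiffOn ℝ 2 (dirD (spaceDir k) U) O :=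
    fun k => hU.dirD hO (by norm_num) _
  have hz0 : z + (0 : ℝ) • a = z := by simp
  have hcut : ∀ s : ℝ, cutoff U v₀ T (z + s • a) =
      U (z + s • a) / (2 * v₀) + z.2 / T * (1 - ∑ i, (z.1 i + s * b i) ^ 2) - 1 / 4 := by
    intro s
    simp only [cutoff, hfst, hsnd]
  have hlin : ∀ s i, HasDerivAt (fun r : ℝ => z.1 i + r * b i) (b i) s := fun s i => by
    simpa using ((hasDerivAt_id s).mul_const (b i)).const_add (z.1 i)
  have hφ : ∀ᶠ s : ℝ in 𝓝 0, HasDerivAt (fun s : ℝ => cutoff U v₀ T (z + s • a))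
      (dirD a U (z + s • a) / (2 * v₀) + z.2 / T * (-∑ i, 2 * (z.1 i + s * b i) * b i)) s := by
    simp only [hcut]
    filter_upwards [eventually_hasDerivAt_line hO (hU.of_le (by norm_num)) hz a] with s hs
    refine ((hs.div_const _).fun_add (HasDerivAt.const_mul _ (HasDerivAt.const_sub _
      (HasDerivAt.fun_sum fun i _ => ?_)))).sub_const _
    simpa using (hlin s i).fun_pow 2
  have hφ' : HasDerivAt (fun s : ℝ => dirD a U (z + s • a) / (2 * v₀) +
      z.2 / T * (-∑ i, 2 * (z.1 i + s * b i) * b i))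
      (dirD a (dirD a U) z / (2 * v₀) + z.2 / T * (-∑ i, 2 * b i * b i)) 0 := by
    have h1 := (eventually_hasDerivAt_line hO (hU.dirD hO (m := 1) (by norm_num) a) hz
      a).self_of_nhds
    rw [hz0] at h1
    exact (h1.div_const _).fun_add (HasDerivAt.const_mul _ (HasDerivAt.fun_neg
      (HasDerivAt.fun_sum fun i _ => ((hlin 0 i).const_mul 2).mul_const _)))
  have hw : ∀ k, ∀ᶠ s : ℝ in 𝓝 0, HasDerivAt (fun s : ℝ => dirD (spaceDir k) U (z + s • a))
      (dirD a (dirD (spaceDir k) U) (z + s • a)) s :=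
    fun k => eventually_hasDerivAt_line hO ((hUk k).of_le (by norm_num)) hz a
  have hw' : ∀ k, HasDerivAt (fun s : ℝ => dirD a (dirD (spaceDir k) U) (z + s • a))
      (dirD a (dirD a (dirD (spaceDir k) U)) z) 0 := by
    intro k
    have h1 := (eventually_hasDerivAt_line hO ((hUk k).dirD hO (m := 1) (by norm_num) a) hz
      a).self_of_nhds
    rwa [hz0] at h1
  have hmax' : IsLocalMax (fun s : ℝ => (Real.exp (K * cutoff U v₀ T (z + s • a)) - 1) ^ 2 *
      (1 + ∑ k, dirD (spaceDir k) U (z + s • a) ^ 2)) 0 := by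
    have hc : Tendsto (fun s : ℝ => z + s • a) (𝓝 0) (𝓝[{y | y.2 ≤ z.2}] z) := by
      refine tendsto_nhdsWithin_iff.2 ⟨?_, Eventually.of_forall fun s => (hsnd s).le⟩
      have : ContinuousAt (fun s : ℝ => z + s • a) 0 := by fun_prop
      simpa [ContinuousAt] using this
    have := hc.eventually hmax
    filter_upwards [this] with s hs
    simpa [testFun] using hs
  have hmain := line_max_conditions hK (by simpa using hpos) hφ hφ' hw hw' hmax'
    (by simpa using hl) (by simpa using hP)
  simp only [hz0, zero_mul, add_zero] at hmain
  have e1 : dirD a U z / (2 * v₀) + z.2 / T * (-∑ i, 2 * z.1 i * b i) =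
      ∑ i, b i * (dirD (spaceDir i) U z / (2 * v₀) - z.2 / T * (2 * z.1 i)) := by
    rw [ha, dirD_sum_smul, Finset.sum_div, mul_neg, ← sub_eq_add_neg, Finset.mul_sum,
      ← Finset.sum_sub_distrib]
    exact Finset.sum_congr rfl fun i _ => by ring
  have e2 : dirD a (dirD a U) z / (2 * v₀) + z.2 / T * (-∑ i, 2 * b i * b i) =
      ∑ i, ∑ j, b i * b j * (dirD (spaceDir i) (dirD (spaceDir j) U) z / (2 * v₀) -
            z.2 / T * (if i = j then 2 else 0)) := by
    rw [ha, dirD_dirD_sum_smul hO (hU.of_le (by norm_num)) hz, Finset.sum_div, mul_neg,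
      ← sub_eq_add_neg, Finset.mul_sum, ← Finset.sum_sub_distrib]
    refine Finset.sum_congr rfl fun i _ => ?_
    have : ∀ j, b i * b j * (dirD (spaceDir i) (dirD (spaceDir j) U) z / (2 * v₀) -
            z.2 / T * (if i = j then 2 else 0)) =
        b i * b j * dirD (spaceDir i) (dirD (spaceDir j) U) z / (2 * v₀) -
          if i = j then z.2 / T * (2 * b i * b j) else 0 := by
      intro j
      split_ifs <;> ring
    simp only [this, Finset.sum_sub_distrib, Finset.sum_ite_eq, Finset.mem_univ, if_true,
      Finset.sum_div]
  have e3 : ∀ k, dirD a (dirD a (dirD (spaceDir k) U)) z =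
      ∑ i, ∑ j, b i * b j * dirD (spaceDir i) (dirD (spaceDir j) (dirD (spaceDir k) U)) z :=
    fun k => by rw [ha, dirD_dirD_sum_smul hO (hUk k) hz]
  have e4 : ∀ k, dirD a (dirD (spaceDir k) U) z =
      ∑ i, b i * dirD (spaceDir i) (dirD (spaceDir k) U) z :=
    fun k => by rw [ha, dirD_sum_smul]
  rw [e1, e2] at hmain
  simp only [e3, e4] at hmain
  exact hmain

/-- The time derivative condition at a maximum of the test function. -/
theorem testFun_time_condition (hO : IsOpen O) (hU : ContDiffOn ℝ 3 U O)
    {v₀ T K : ℝ} (hK : 0 < K) {z : EuclideanSpace ℝ (Fin n) × ℝ} (hz : z ∈ O)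
    (hpos : 0 < cutoff U v₀ T z)
    (hmax : IsLocalMaxOn (testFun U v₀ T K) {y | y.2 ≤ z.2} z) {l P : ℝ}
    (hl : l = K * Real.exp (K * cutoff U v₀ T z) / (Real.exp (K * cutoff U v₀ T z) - 1))
    (hP : P = 1 + ∑ k, dirD (spaceDir k) U z ^ 2) :
    0 ≤ l * (dirD (timeDir n) U z / (2 * v₀) + (1 - ∑ i, z.1 i ^ 2) / T) * P +
      ∑ k, dirD (spaceDir k) U z * dirD (timeDir n) (dirD (spaceDir k) U) z := by
  set a := timeDir n with ha
  have hfst : ∀ s : ℝ, (z + s • a).1 = z.1 := fun s => by simp [ha, timeDir]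
  have hsnd : ∀ s : ℝ, (z + s • a).2 = z.2 + s := fun s => by simp [ha, timeDir]
  have hz0 : z + (0 : ℝ) • a = z := by simp
  have hφ : HasDerivAt (fun s : ℝ => cutoff U v₀ T (z + s • a))
      (dirD a U z / (2 * v₀) + (1 - ∑ i, z.1 i ^ 2) / T) 0 := by
    simp only [cutoff, hfst, hsnd]
    have h1 := (eventually_hasDerivAt_line hO (hU.of_le (by norm_num)) hz a).self_of_nhds
    rw [hz0] at h1
    have h2 : HasDerivAt (fun s : ℝ => (z.2 + s) / T * (1 - ∑ i, z.1 i ^ 2))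
        (1 / T * (1 - ∑ i, z.1 i ^ 2)) 0 :=
      (((hasDerivAt_id (0 : ℝ)).const_add z.2).div_const T).mul_const _
    exact (((h1.div_const (2 * v₀)).fun_add h2).sub_const (1 / 4)).congr_deriv (by ring)
  have hw : ∀ k, HasDerivAt (fun s : ℝ => dirD (spaceDir k) U (z + s • a))
      (dirD a (dirD (spaceDir k) U) z) 0 := by
    intro k
    have h1 := (eventually_hasDerivAt_line hO (hU.dirD hO (m := 1) (by norm_num) (spaceDir k)) hz
      a).self_of_nhds
    rwa [hz0] at h1
  have hd := (((hφ.const_mul K).exp.sub_const 1).fun_pow 2).fun_mul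
    ((HasDerivAt.fun_sum (u := Finset.univ) fun k _ => (hw k).fun_pow 2).const_add 1)
  have hmax' : IsLocalMaxOn (fun s : ℝ => (Real.exp (K * cutoff U v₀ T (z + s • a)) - 1) ^ 2 *
      (1 + ∑ k, dirD (spaceDir k) U (z + s • a) ^ 2)) (Set.Iic 0) 0 := by
    have hc : Tendsto (fun s : ℝ => z + s • a) (𝓝[Set.Iic 0] 0) (𝓝[{y | y.2 ≤ z.2}] z) := by
      refine tendsto_nhdsWithin_iff.2 ⟨?_, ?_⟩
      · have : ContinuousAt (fun s : ℝ => z + s • a) 0 := by fun_prop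
        exact Tendsto.mono_left (by simpa [ContinuousAt] using this) nhdsWithin_le_nhds
      · filter_upwards [self_mem_nhdsWithin] with s hs
        have : s ≤ 0 := hs
        simpa [hsnd] using this
    filter_upwards [hc.eventually hmax] with s hs
    simpa [testFun] using hs
  have hn := hmax'.hasFDerivWithinAt_nonpos hd.hasFDerivAt.hasFDerivWithinAt
    (y := -1) (mem_posTangentConeAt_of_segment_subset (by
      rw [segment_symm, segment_eq_Icc (by norm_num)]
      exact fun s hs => by simpa using hs.2))
  simp only [hz0] at hn
  rw [← hP] at hn
  have hE : 0 < Real.exp (K * cutoff U v₀ T z) - 1 := by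
    have := Real.add_one_lt_exp (mul_pos hK hpos).ne'
    nlinarith [mul_pos hK hpos]
  set E := Real.exp (K * cutoff U v₀ T z)
  set φt := dirD a U z / (2 * v₀) + (1 - ∑ i, z.1 i ^ 2) / T
  have hq : ∑ k, (2 : ℕ) * dirD (spaceDir k) U z ^ (2 - 1) * dirD a (dirD (spaceDir k) U) z =
      2 * ∑ k, dirD (spaceDir k) U z * dirD a (dirD (spaceDir k) U) z := by
    rw [Finset.mul_sum]
    exact Finset.sum_congr rfl fun k _ => by push_cast; ring
  rw [hq] at hn
  have hEl : E * K = l * (E - 1) := by rw [hl]; field_simp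
  have : 0 ≤ 2 * (E - 1) ^ 2 * (l * φt * P +
      ∑ k, dirD (spaceDir k) U z * dirD a (dirD (spaceDir k) U) z) := by
    simp only [ContinuousLinearMap.toSpanSingleton_apply, smul_eq_mul] at hn
    have e : E * (K * φt) = l * (E - 1) * φt := by rw [← hEl]; ring
    rw [e] at hn
    push_cast at hn
    linarith
  exact nonneg_of_mul_nonneg_right this (by positivity)

/-- The equation differentiated in the direction of the gradient. -/
theorem differentiated_equation (hO : IsOpen O) (hU : ContDiffOn ℝ 3 U O) {A : ℝ}
    (hPDE : ∀ z ∈ O, dirD (timeDir n) U z =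
      (∑ i, ∑ j, ((if i = j then (1 : ℝ) else 0) - dirD (spaceDir i) U z * dirD (spaceDir j) U z /
        (1 + ∑ k, dirD (spaceDir k) U z ^ 2)) * dirD (spaceDir i) (dirD (spaceDir j) U) z) +
      A * Real.sqrt (1 + ∑ k, dirD (spaceDir k) U z ^ 2))
    {z : EuclideanSpace ℝ (Fin n) × ℝ} (hz : z ∈ O) {p r : Fin n → ℝ} {P : ℝ}
    (hp : ∀ k, p k = dirD (spaceDir k) U z) (hP : P = 1 + ∑ k, p k ^ 2)
    (hr : ∀ i, r i = ∑ k, p k * dirD (spaceDir k) (dirD (spaceDir i) U) z) :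
    ∑ k, p k * dirD (timeDir n) (dirD (spaceDir k) U) z =
      ∑ i, ∑ j, (-((r i * p j + p i * r j) * P - p i * p j * ∑ k, 2 * p k * r k) / P ^ 2 *
        dirD (spaceDir i) (dirD (spaceDir j) U) z +
        ((if i = j then (1 : ℝ) else 0) - p i * p j / P) *
          ∑ k, p k * dirD (spaceDir i) (dirD (spaceDir j) (dirD (spaceDir k) U)) z) +
        A * ((∑ k, 2 * p k * r k) / (2 * Real.sqrt P)) := by
  have hPpos : 0 < P := by
    have : 0 ≤ ∑ k, p k ^ 2 := Finset.sum_nonneg fun _ _ => sq_nonneg _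
    linarith
  have hU1 : ∀ a, ContDiffOn ℝ 2 (dirD a U) O := fun a => hU.dirD hO (by norm_num) a
  set a : EuclideanSpace ℝ (Fin n) × ℝ := ∑ i, p i • spaceDir i with ha
  have hz0 : z + (0 : ℝ) • a = z := by simp
  have hline : ∀ {F : EuclideanSpace ℝ (Fin n) × ℝ → ℝ}, ContDiffOn ℝ 1 F O →
      HasDerivAt (fun s : ℝ => F (z + s • a)) (∑ k, p k * dirD (spaceDir k) F z) 0 := by
    intro F hF
    have h1 := (eventually_hasDerivAt_line hO hF hz a).self_of_nhds
    rwa [hz0, ha, dirD_sum_smul] at h1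
  have hw : ∀ i, HasDerivAt (fun s : ℝ => dirD (spaceDir i) U (z + s • a)) (r i) 0 := fun i => by
    rw [hr]
    exact hline ((hU1 _).of_le (by norm_num))
  have hH : ∀ i j, HasDerivAt (fun s : ℝ => dirD (spaceDir i) (dirD (spaceDir j) U) (z + s • a))
      (∑ k, p k * dirD (spaceDir i) (dirD (spaceDir j) (dirD (spaceDir k) U)) z) 0 := by
    intro i j
    have h1 := hline ((hU1 (spaceDir j)).dirD hO (m := 1) (by norm_num) (spaceDir i))
    convert h1 using 1
    refine Finset.sum_congr rfl fun k _ => ?_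
    rw [dirD_comm hO (hU1 (spaceDir j)) hz]
    congr 1
    refine dirD_congr_of_eventuallyEq ?_ _
    filter_upwards [hO.mem_nhds hz] with y hy
    exact dirD_comm hO (hU.of_le (by norm_num)) hy _ _
  have ht := hline ((hU1 (timeDir n)).of_le (by norm_num))
  have hS : HasDerivAt (fun s : ℝ => 1 + ∑ k, dirD (spaceDir k) U (z + s • a) ^ 2)
      (∑ k, 2 * p k * r k) 0 := by
    refine HasDerivAt.const_add 1 (HasDerivAt.fun_sum fun k _ => ?_)
    simpa [hp k] using (hw k).fun_pow 2
  have hS0 : 1 + ∑ k, dirD (spaceDir k) U (z + (0 : ℝ) • a) ^ 2 = P := by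
    rw [hz0, hP]
    simp only [hp]
  have hS0' : 1 + ∑ k, dirD (spaceDir k) U (z + (0 : ℝ) • a) ^ 2 ≠ 0 := by
    rw [hS0]; exact hPpos.ne'
  have hR := (HasDerivAt.fun_sum (u := Finset.univ) fun i _ =>
      HasDerivAt.fun_sum (u := Finset.univ) fun j _ =>
        ((((hw i).fun_mul (hw j)).fun_div hS hS0').const_sub
          (if i = j then (1 : ℝ) else 0)).fun_mul (hH i j)).fun_add
      ((hS.sqrt hS0').const_mul A)
  have huniq := ht.unique (hR.congr_of_eventuallyEq (by
    have hc : ContinuousAt (fun s : ℝ => z + s • a) 0 := by fun_prop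
    filter_upwards [hc.eventually_mem (by simpa using hO.mem_nhds hz)] with s hs
    exact hPDE _ hs))
  rw [hS0] at huniq
  simp only [hz0, ← hp] at huniq
  have hcomm : ∑ k, p k * dirD (timeDir n) (dirD (spaceDir k) U) z =
      ∑ k, p k * dirD (spaceDir k) (dirD (timeDir n) U) z :=
    Finset.sum_congr rfl fun k _ => by rw [dirD_comm hO (hU.of_le (by norm_num)) hz]
  rw [hcomm, huniq]
  simp only [neg_div]

/-- The gradient bound at a maximum of the test function. -/
theorem gradient_lt_of_isLocalMaxOn_testFun (hO : IsOpen O) (hU : ContDiffOn ℝ 3 U O)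
    {A T v₀ K : ℝ} (hA : 0 < A) (hT : 0 < T) (hv₀ : 0 < v₀)
    (hK : K = 20 * v₀ ^ 2 * (4 * (n : ℝ) + 1 / T + 4 * A + A / (2 * v₀)) + 2)
    (hPDE : ∀ z ∈ O, dirD (timeDir n) U z =
      (∑ i, ∑ j, ((if i = j then (1 : ℝ) else 0) - dirD (spaceDir i) U z * dirD (spaceDir j) U z /
        (1 + ∑ k, dirD (spaceDir k) U z ^ 2)) * dirD (spaceDir i) (dirD (spaceDir j) U) z) +
      A * Real.sqrt (1 + ∑ k, dirD (spaceDir k) U z ^ 2))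
    {z : EuclideanSpace ℝ (Fin n) × ℝ} (hz : z ∈ O) (hx : ∑ i, z.1 i ^ 2 ≤ 1) (ht0 : 0 ≤ z.2)
    (htT : z.2 ≤ T) (hpos : 0 < cutoff U v₀ T z)
    (hmax : IsLocalMaxOn (testFun U v₀ T K) {y | y.2 ≤ z.2} z) :
    Real.sqrt (1 + ∑ k, dirD (spaceDir k) U z ^ 2) < 3 + 16 * v₀ := by
  have hK0 : 0 < K := by rw [hK]; positivity
  obtain ⟨l, hl⟩ : ∃ l, l = K * Real.exp (K * cutoff U v₀ T z) /
    (Real.exp (K * cutoff U v₀ T z) - 1) := ⟨_, rfl⟩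
  obtain ⟨P, hP⟩ : ∃ P, P = 1 + ∑ k, dirD (spaceDir k) U z ^ 2 := ⟨_, rfl⟩
  have hl0 : 0 < l := by
    have : 1 < Real.exp (K * cutoff U v₀ T z) := Real.one_lt_exp_iff.2 (mul_pos hK0 hpos)
    rw [hl]
    exact div_pos (by positivity) (by linarith)
  have hspace := testFun_space_conditions hO hU hK0 hz hpos hmax hl hP
  have htime := testFun_time_condition hO hU hK0 hz hpos hmax hl hP
  have hdiff := differentiated_equation hO hU hPDE hz (p := fun k => dirD (spaceDir k) U z)
    (fun _ => rfl) hP (fun _ => rfl)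
  have hH : ∀ i j, dirD (spaceDir i) (dirD (spaceDir j) U) z =
      dirD (spaceDir j) (dirD (spaceDir i) U) z :=
    fun i j => dirD_comm hO (hU.of_le (by norm_num)) hz _ _
  have hcut := cutoff_inequality (K := K)
    (Φ := fun i => dirD (spaceDir i) U z / (2 * v₀) - z.2 / T * (2 * z.1 i))
    (Ψ := fun i j => dirD (spaceDir i) (dirD (spaceDir j) U) z / (2 * v₀) -
      z.2 / T * (if i = j then 2 else 0)) hl0 hP hH (fun _ => rfl) ?_ ?_ htime hdiff
  · rw [← hP]
    have hτ1 : z.2 / T ≤ 1 := by rw [div_le_one hT]; exact htT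
    exact sqrt_lt_of_cutoff_inequality hA hT hv₀ (div_nonneg ht0 hT.le) hτ1 hx hP
      (fun _ => rfl) (fun _ _ => rfl) rfl (by rw [hPDE z hz, ← hP]) (hK ▸ hcut)
  · intro i
    have := (hspace (Pi.single i 1)).1
    simp only [Pi.single_apply, ite_mul, one_mul, zero_mul, Finset.sum_ite_eq', Finset.mem_univ,
      if_true] at this
    rw [← this]
    congr 1
    exact Finset.sum_congr rfl fun k _ => by rw [hH]
  · intro b
    have := (hspace b).2
    refine le_trans (le_of_eq ?_) (sub_nonpos.2 this)
    have e1 : ∑ i, ∑ j, b i * b j * ∑ k, dirD (spaceDir k) U z *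
        dirD (spaceDir i) (dirD (spaceDir j) (dirD (spaceDir k) U)) z =
        ∑ k, dirD (spaceDir k) U z * ∑ i, ∑ j, b i * b j *
          dirD (spaceDir i) (dirD (spaceDir j) (dirD (spaceDir k) U)) z := by
      simp only [Finset.mul_sum]
      rw [Finset.sum_comm_cycle]
      exact Finset.sum_congr rfl fun k _ => Finset.sum_congr rfl fun i _ =>
        Finset.sum_congr rfl fun j _ => by ring
    rw [← e1, sq (∑ i, b i * _), Finset.sum_mul_sum]
    simp only [Finset.mul_sum, ← Finset.sum_sub_distrib]
    refine Finset.sum_congr rfl fun i _ => Finset.sum_congr rfl fun j _ => ?_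
    simp only [← Finset.mul_sum]
    ring

end SpaceTime

theorem continuousOn_cutoff {n : ℕ} {U : EuclideanSpace ℝ (Fin n) × ℝ → ℝ}
    {S : Set (EuclideanSpace ℝ (Fin n) × ℝ)} (hU : ContinuousOn U S) (v₀ T : ℝ) :
    ContinuousOn (cutoff U v₀ T) S := by
  unfold cutoff
  fun_prop

theorem continuousOn_testFun {n : ℕ} {U : EuclideanSpace ℝ (Fin n) × ℝ → ℝ}
    {O : Set (EuclideanSpace ℝ (Fin n) × ℝ)} (hO : IsOpen O) (hU : ContDiffOn ℝ 3 U O)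
    (v₀ T K : ℝ) : ContinuousOn (testFun U v₀ T K) O := by
  have h1 := continuousOn_cutoff hU.continuousOn v₀ T
  have h2 : ∀ k, ContinuousOn (dirD (spaceDir k) U) O := fun k =>
    (hU.dirD hO (m := 2) (by norm_num) _).continuousOn
  unfold testFun
  fun_prop

theorem le_exp_of_test_le {K φ G P M : ℝ} (hK : 2 ≤ K) (hφ0 : 0 < φ) (hφ : φ ≤ 3 / 4)
    (hM : 0 ≤ M) (hP : Real.sqrt P ≤ M)
    (h : (Real.exp (K * (1 / 4)) - 1) ^ 2 * G ≤ (Real.exp (K * φ) - 1) ^ 2 * P) :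
    Real.sqrt G ≤ M * Real.exp (2 * K) := by
  set a := Real.exp (K * (1 / 4)) with ha
  have ha1 : 3 / 2 ≤ a := by
    have := Real.add_one_le_exp (K * (1 / 4))
    linarith
  have h3 : Real.exp (K * (3 / 4)) = a ^ 3 := by
    rw [ha, ← Real.exp_nat_mul]
    congr 1
    push_cast
    ring
  have h8 : Real.exp (2 * K) = a ^ 8 := by
    rw [ha, ← Real.exp_nat_mul]
    congr 1
    push_cast
    ring
  have hφ1 : Real.exp (K * φ) ≤ a ^ 3 := by
    rw [← h3]
    exact Real.exp_le_exp.2 (mul_le_mul_of_nonneg_left hφ (by linarith))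
  have hφ2 : 1 ≤ Real.exp (K * φ) := Real.one_le_exp (by positivity)
  have hs := Real.sqrt_le_sqrt h
  rw [Real.sqrt_mul (sq_nonneg _), Real.sqrt_mul (sq_nonneg _), Real.sqrt_sq (by linarith),
    Real.sqrt_sq (by linarith)] at hs
  have hs2 : (Real.exp (K * φ) - 1) * Real.sqrt P ≤ (a ^ 3 - 1) * M :=
    mul_le_mul (by linarith) hP (Real.sqrt_nonneg _) (by linarith)
  have hs3 : Real.sqrt G ≤ (a ^ 2 + a + 1) * M := by
    refine le_of_mul_le_mul_left (a := a - 1) ?_ (by linarith)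
    calc (a - 1) * Real.sqrt G ≤ (a ^ 3 - 1) * M := hs.trans hs2
      _ = (a - 1) * ((a ^ 2 + a + 1) * M) := by ring
  have ha2 : 9 / 4 ≤ a ^ 2 := by nlinarith
  have ha4 : 5 ≤ a ^ 4 := by nlinarith
  have ha8 : a ^ 2 + a + 1 ≤ a ^ 8 := by nlinarith
  rw [h8, mul_comm M]
  exact hs3.trans (mul_le_mul_of_nonneg_right ha8 hM)

/-- one-sided interior gradient estimate, driving force upward, `u < 0`,
`u(0,T) = −v₀`: then `|∇u(0,T)| ≤ (3 + 16v₀)·e^{2K}` with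
`K = 20v₀²(4n + 1/T + 4A + A/(2v₀)) + 2`. -/
theorem gradient_estimate_negative (n : ℕ) (hn : 1 ≤ n) (A T v₀ : ℝ)
    (hA : 0 < A) (hT : 0 < T) (hv₀ : 0 < v₀)
    (u : EuclideanSpace ℝ (Fin n) → ℝ → ℝ)
    (hC3 : ContDiffOn ℝ 3 (fun p : EuclideanSpace ℝ (Fin n) × ℝ => u p.1 p.2)
      (Metric.ball (0 : EuclideanSpace ℝ (Fin n)) 1 ×ˢ Set.Ioo (0 : ℝ) (2 * T)))
    (hC0 : ContinuousOn (fun p : EuclideanSpace ℝ (Fin n) × ℝ => u p.1 p.2)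
      (closure (Metric.ball (0 : EuclideanSpace ℝ (Fin n)) 1 ×ˢ Set.Ioo (0 : ℝ) (2 * T))))
    (hneg : ∀ x t, (x, t) ∈
        Metric.ball (0 : EuclideanSpace ℝ (Fin n)) 1 ×ˢ Set.Ioo (0 : ℝ) (2 * T) → u x t < 0)
    (hval : u 0 T = -v₀)
    (hPDE : ∀ x t, (x, t) ∈
        Metric.ball (0 : EuclideanSpace ℝ (Fin n)) 1 ×ˢ Set.Ioo (0 : ℝ) (2 * T) →
      deriv (fun s => u x s) t =
        (∑ i, ∑ j, ((if i = j then (1 : ℝ) else 0)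
            - pd u t x i * pd u t x j / (1 + ∑ k, (pd u t x k) ^ 2)) * pd2 u t x i j)
          + A * Real.sqrt (1 + ∑ k, (pd u t x k) ^ 2)) :
    Real.sqrt (∑ i, (pd u T 0 i) ^ 2) ≤
      (3 + 16 * v₀) *
        Real.exp (2 * (20 * v₀ ^ 2 * (4 * (n : ℝ) + 1 / T + 4 * A + A / (2 * v₀)) + 2)) := by
  set B : Set (EuclideanSpace ℝ (Fin n)) := Metric.ball 0 1
  set O : Set (EuclideanSpace ℝ (Fin n) × ℝ) := B ×ˢ Set.Ioo (0 : ℝ) (2 * T) with hOdef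
  set U : EuclideanSpace ℝ (Fin n) × ℝ → ℝ := fun p => u p.1 p.2 with hUdef
  set K : ℝ := 20 * v₀ ^ 2 * (4 * (n : ℝ) + 1 / T + 4 * A + A / (2 * v₀)) + 2 with hKdef
  have hK2 : 2 ≤ K := by
    have : 0 ≤ 20 * v₀ ^ 2 * (4 * (n : ℝ) + 1 / T + 4 * A + A / (2 * v₀)) := by positivity
    linarith
  have hO : IsOpen O := Metric.isOpen_ball.prod isOpen_Ioo
  have hdiff : ∀ {F : EuclideanSpace ℝ (Fin n) × ℝ → ℝ}, ContDiffOn ℝ 1 F O → ∀ z ∈ O,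
      DifferentiableAt ℝ F z := fun hF z hz =>
    (hF.differentiableOn (by norm_num)).differentiableAt (hO.mem_nhds hz)
  have hU1 : ∀ a, ContDiffOn ℝ 2 (dirD a U) O := fun a => hC3.dirD hO (by norm_num) a
  have hpd : ∀ x t i, (x, t) ∈ O → pd u t x i = dirD (spaceDir i) U (x, t) := fun x t i hz =>
    fderiv_slice (hdiff (hC3.of_le (by norm_num)) _ hz) i
  have hpd2 : ∀ x t i j, (x, t) ∈ O →
      pd2 u t x i j = dirD (spaceDir i) (dirD (spaceDir j) U) (x, t) := by
    intro x t i j hz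
    have hc : ContinuousAt (fun y : EuclideanSpace ℝ (Fin n) => (y, t)) x := by fun_prop
    have hev : (fun y => pd u t y j) =ᶠ[𝓝 x] fun y => dirD (spaceDir j) U (y, t) := by
      filter_upwards [hc.eventually_mem (hO.mem_nhds hz)] with y hy using hpd y t j hy
    rw [pd2, hev.fderiv_eq]
    exact fderiv_slice (hdiff ((hU1 _).of_le (by norm_num)) _ hz) i
  have hPDE' : ∀ z ∈ O, dirD (timeDir n) U z =
      (∑ i, ∑ j, ((if i = j then (1 : ℝ) else 0) - dirD (spaceDir i) U z * dirD (spaceDir j) U z /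
        (1 + ∑ k, dirD (spaceDir k) U z ^ 2)) * dirD (spaceDir i) (dirD (spaceDir j) U) z) +
      A * Real.sqrt (1 + ∑ k, dirD (spaceDir k) U z ^ 2) := by
    rintro ⟨x, t⟩ hz
    have h := hPDE x t hz
    simp only [hpd x t _ hz, hpd2 x t _ _ hz] at h
    rw [← h]
    exact (deriv_slice (hdiff (hC3.of_le (by norm_num)) _ hz)).symm
  have hnonpos : ∀ z ∈ closure O, U z ≤ 0 := by
    intro z hz
    have h1 : U z ∈ closure (U '' O) := hC0.image_closure (Set.mem_image_of_mem U hz)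
    refine closure_minimal ?_ isClosed_Iic h1
    rintro _ ⟨⟨x, t⟩, hy, rfl⟩
    exact (hneg x t hy).le
  set D : Set (EuclideanSpace ℝ (Fin n) × ℝ) := Metric.closedBall 0 1 ×ˢ Set.Icc (0 : ℝ) T
  have hDcl : D ⊆ closure O := by
    rw [hOdef, closure_prod_eq, closure_ball _ one_ne_zero, closure_Ioo (by positivity)]
    exact Set.prod_mono le_rfl (Set.Icc_subset_Icc_right (by linarith))
  have hDcomp : IsCompact D := (isCompact_closedBall _ _).prod isCompact_Icc
  have hcutD := continuousOn_cutoff (hC0.mono hDcl) v₀ T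
  set C : Set (EuclideanSpace ℝ (Fin n) × ℝ) := D ∩ cutoff U v₀ T ⁻¹' Set.Ici 0
  have hCcomp : IsCompact C := hDcomp.of_isClosed_subset
    (hcutD.preimage_isClosed_of_isClosed hDcomp.isClosed isClosed_Ici) Set.inter_subset_left
  have hCO : C ⊆ O := by
    rintro ⟨x, t⟩ ⟨hD, hc⟩
    have hu := hnonpos _ (hDcl hD)
    obtain ⟨hx, ht⟩ := hD
    have hc' : 0 ≤ U (x, t) / (2 * v₀) + t / T * (1 - ∑ i, x i ^ 2) - 1 / 4 := hc
    rw [← EuclideanSpace.real_norm_sq_eq] at hc'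
    have h1 : U (x, t) / (2 * v₀) ≤ 0 := div_nonpos_of_nonpos_of_nonneg hu (by positivity)
    have h2 : 0 < t / T * (1 - ‖x‖ ^ 2) := by linarith
    have ht' : t ∈ Set.Icc 0 T := ht
    have h3 : 0 < t := by
      refine lt_of_le_of_ne ht'.1 fun h => ?_
      rw [← h] at h2
      simp at h2
    have h4 : 0 < 1 - ‖x‖ ^ 2 := pos_of_mul_pos_right h2 (by positivity)
    refine ⟨?_, h3, by linarith [ht'.2]⟩
    rw [mem_ball_zero_iff]
    nlinarith [norm_nonneg x]
  have hcut1 : cutoff U v₀ T (0, T) = 1 / 4 := by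
    simp only [cutoff, hUdef, hval]
    simp
    field_simp
    norm_num
  have h1C : ((0, T) : EuclideanSpace ℝ (Fin n) × ℝ) ∈ C :=
    ⟨⟨by simp, by simp [hT.le]⟩, by simp [hcut1]⟩
  obtain ⟨z, hzC, hzmax⟩ := hCcomp.exists_isMaxOn ⟨_, h1C⟩
    ((continuousOn_testFun hO hC3 v₀ T K).mono hCO)
  have hzO := hCO hzC
  have hle : testFun U v₀ T K (0, T) ≤ testFun U v₀ T K z := hzmax h1C
  have hzpos : 0 < cutoff U v₀ T z := by
    refine lt_of_le_of_ne hzC.2 fun h => ?_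
    have h0 : testFun U v₀ T K z = 0 := by simp [testFun, ← h]
    have h1 : 0 < testFun U v₀ T K (0, T) := by
      rw [testFun, hcut1]
      have : 1 < Real.exp (K * (1 / 4)) := Real.one_lt_exp_iff.2 (by linarith)
      have h2 : 0 ≤ ∑ k, dirD (spaceDir k) U ((0, T) : EuclideanSpace ℝ (Fin n) × ℝ) ^ 2 :=
        Finset.sum_nonneg fun _ _ => sq_nonneg _
      exact mul_pos (pow_pos (by linarith) 2) (by linarith)
    linarith
  have hloc : IsLocalMaxOn (testFun U v₀ T K) {y | y.2 ≤ z.2} z := by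
    have hcont : ContinuousAt (cutoff U v₀ T) z :=
      (continuousOn_cutoff hC3.continuousOn v₀ T).continuousAt (hO.mem_nhds hzO)
    filter_upwards [self_mem_nhdsWithin, mem_nhdsWithin_of_mem_nhds (hO.mem_nhds hzO),
      mem_nhdsWithin_of_mem_nhds (hcont.eventually_mem (Ioi_mem_nhds hzpos))] with y hy1 hy2 hy3
    have hy4 : 0 ≤ cutoff U v₀ T y := le_of_lt hy3
    exact hzmax ⟨⟨Metric.ball_subset_closedBall hy2.1, hy2.2.1.le, le_trans hy1 hzC.1.2.2⟩,
      hy4⟩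
  have hx1 : ∑ i, z.1 i ^ 2 ≤ 1 := by
    rw [← EuclideanSpace.real_norm_sq_eq]
    have := mem_closedBall_zero_iff.1 hzC.1.1
    nlinarith [norm_nonneg z.1]
  have hbound := gradient_lt_of_isLocalMaxOn_testFun hO hC3 hA hT hv₀ hKdef hPDE' hzO hx1
    hzC.1.2.1 hzC.1.2.2 hzpos hloc
  have hcutle : cutoff U v₀ T z ≤ 3 / 4 := by
    have h1 : U z / (2 * v₀) ≤ 0 :=
      div_nonpos_of_nonpos_of_nonneg (hnonpos z (hDcl hzC.1)) (by positivity)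
    have h2 : z.2 / T * (1 - ∑ i, z.1 i ^ 2) ≤ 1 := by
      have h3 : z.2 / T ≤ 1 := (div_le_one hT).2 hzC.1.2.2
      have h4 : 0 ≤ ∑ i, z.1 i ^ 2 := Finset.sum_nonneg fun _ _ => sq_nonneg _
      exact mul_le_one₀ h3 (by linarith) (by linarith)
    unfold cutoff
    linarith
  rw [testFun, testFun, hcut1] at hle
  have hfin := le_exp_of_test_le hK2 hzpos hcutle (by positivity) hbound.le hle
  refine le_trans (Real.sqrt_le_sqrt ?_) hfin
  simp only [hpd 0 T _ (hCO h1C)]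
  linarith
end

section
/- Let n ≥ 1, A > 0, T > 0, v₀ > 0, and let Ω_T = B₁(0) × (0, 2T) ⊂ ℝⁿ × ℝ. Suppose u ∈ C³(Ω_T) ∩ C⁰(closure of Ω_T) satisfies the quasilinear equation u_t = Σ_{i,j=1}^n (δ_{ij} − u_{x_i}u_{x_j}/(1 + |∇u|²))·u_{x_i x_j} − A·√(1 + |∇u|²) in Ω_T, with u > 0 throughout Ω_T and u(0, T) = v₀. Then |∇u(0, T)| ≤ (3 + 16·v₀)·e^{2K}, where K = 20·v₀²·(4n + 1/T + 4A + A/(2v₀)) + 2. -/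
open Filter Topology

/-- The derivative of `f` in direction `a`, as a function of the base point. -/
noncomputable def dirDeriv {V : Type*} [NormedAddCommGroup V] [NormedSpace ℝ V] (a : V)
    (f : V → ℝ) : V → ℝ :=
  fun z => fderiv ℝ f z a

/-- The mean curvature operator for graphs with frozen gradient `q`, applied to a matrix `M`. -/
noncomputable def mcOp {n : ℕ} (q : Fin n → ℝ) (M : Fin n → Fin n → ℝ) : ℝ :=
  ∑ i, ∑ j, ((if i = j then (1 : ℝ) else 0) - q i * q j / (1 + ∑ k, q k ^ 2)) * M i j

section mcOp

variable {n : ℕ} (q : Fin n → ℝ)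

theorem mcOp_add (M N : Fin n → Fin n → ℝ) :
    mcOp q (fun i j => M i j + N i j) = mcOp q M + mcOp q N := by
  simp only [mcOp, mul_add, Finset.sum_add_distrib]

theorem mcOp_mul_left (c : ℝ) (M : Fin n → Fin n → ℝ) :
    mcOp q (fun i j => c * M i j) = c * mcOp q M := by
  simp only [mcOp, Finset.mul_sum]
  exact Finset.sum_congr rfl fun i _ => Finset.sum_congr rfl fun j _ => by ring

theorem mcOp_eq (M : Fin n → Fin n → ℝ) :
    mcOp q M = ∑ i, M i i - (∑ i, ∑ j, q i * q j * M i j) / (1 + ∑ k, q k ^ 2) := by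
  simp only [mcOp, sub_mul, Finset.sum_sub_distrib, Finset.sum_div]
  congr 1
  · simp
  · exact Finset.sum_congr rfl fun i _ => Finset.sum_congr rfl fun j _ => by ring

theorem mcOp_outer (X Y : Fin n → ℝ) :
    mcOp q (fun i j => X i * Y j) =
      ∑ i, X i * Y i - (∑ i, q i * X i) * (∑ i, q i * Y i) / (1 + ∑ k, q k ^ 2) := by
  rw [mcOp_eq, Finset.sum_mul_sum]
  congr 2
  exact Finset.sum_congr rfl fun i _ => Finset.sum_congr rfl fun j _ => by ring

theorem mcOp_one_le : mcOp q (fun i j => if i = j then (1 : ℝ) else 0) ≤ n := by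
  rw [mcOp_eq]
  have : 0 ≤ (∑ i, ∑ j, q i * q j * (if i = j then (1 : ℝ) else 0)) / (1 + ∑ k, q k ^ 2) := by
    apply div_nonneg _ (by positivity)
    simp only [mul_ite, mul_one, mul_zero, Finset.sum_ite_eq, Finset.mem_univ, if_true]
    exact Finset.sum_nonneg fun i _ => mul_self_nonneg _
  simp only [if_true, Finset.sum_const, Finset.card_univ, Fintype.card_fin, nsmul_eq_mul, mul_one]
  linarith

theorem mcOp_nonpos (M : Fin n → Fin n → ℝ)
    (hM : ∀ ξ : Fin n → ℝ, ∑ i, ∑ j, ξ i * ξ j * M i j ≤ 0) : mcOp q M ≤ 0 := by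
  set S := ∑ k, q k ^ 2 with hS
  have hS0 : 0 ≤ S := by positivity
  set v := √(1 + S) with hv
  have hv0 : 0 < v := Real.sqrt_pos.2 (by positivity)
  have hvv : v ^ 2 = 1 + S := Real.sq_sqrt (by positivity)
  set c := 1 / (v * (v + 1)) with hc
  have hcc : c ^ 2 * S - 2 * c = - (1 / (1 + S)) := by
    rw [← hvv, show S = v ^ 2 - 1 by linarith, hc]
    field_simp
    ring
  have key : mcOp q M = ∑ k, ∑ i, ∑ j, ((if i = k then (1 : ℝ) else 0) - c * q k * q i) *
      ((if j = k then (1 : ℝ) else 0) - c * q k * q j) * M i j := by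
    rw [Finset.sum_comm]
    refine Finset.sum_congr rfl fun i _ => ?_
    rw [Finset.sum_comm]
    refine Finset.sum_congr rfl fun j _ => ?_
    rw [← Finset.sum_mul]
    congr 1
    have : ∀ k, ((if i = k then (1 : ℝ) else 0) - c * q k * q i) *
      ((if j = k then (1 : ℝ) else 0) - c * q k * q j) =
      (if i = k then (if j = k then (1 : ℝ) else 0) else 0) - (if i = k then c * q k * q j else 0)
      - (if j = k then c * q k * q i else 0) + c ^ 2 * q i * q j * q k ^ 2 := by
      intro k
      split_ifs <;> ring
    simp only [this, Finset.sum_add_distrib, Finset.sum_sub_distrib, ← Finset.mul_sum, ← hS]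
    simp only [Finset.sum_ite_eq, Finset.mem_univ, if_true]
    have h2 : q i * q j / (1 + S) = - (c ^ 2 * S - 2 * c) * (q i * q j) := by rw [hcc]; ring
    rw [h2]
    simp only [eq_comm (a := j)]
    ring
  rw [key]
  exact Finset.sum_nonpos fun k _ => hM fun i => (if i = k then (1 : ℝ) else 0) - c * q k * q i

end mcOp

section dirDeriv

variable {V : Type*} [NormedAddCommGroup V] [NormedSpace ℝ V] {f g : V → ℝ} {z : V}

theorem ContDiffAt.dirDeriv {m k : WithTop ℕ∞} (hf : ContDiffAt ℝ k f z) (a : V)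
    (hmk : m + 1 ≤ k) : ContDiffAt ℝ m (dirDeriv a f) z :=
  (hf.fderiv_right hmk).clm_apply contDiffAt_const

theorem Filter.EventuallyEq.dirDeriv (h : f =ᶠ[𝓝 z] g) (a : V) :
    dirDeriv a f =ᶠ[𝓝 z] dirDeriv a g :=
  h.fderiv.fun_comp fun L => L a

theorem dirDeriv_sum {ι : Type*} (s : Finset ι) (c : ι → ℝ) (e : ι → V) (z : V) :
    dirDeriv (∑ i ∈ s, c i • e i) f z = ∑ i ∈ s, c i * dirDeriv (e i) f z := by
  simp [dirDeriv]

theorem dirDeriv_comm (hf : ContDiffAt ℝ 2 f z) (a b : V) :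
    dirDeriv a (dirDeriv b f) z = dirDeriv b (dirDeriv a f) z := by
  have hd : DifferentiableAt ℝ (fderiv ℝ f) z :=
    (hf.fderiv_right (m := 1) (by norm_num)).differentiableAt (by norm_num)
  have h : ∀ a b : V, dirDeriv a (dirDeriv b f) z = fderiv ℝ (fderiv ℝ f) z a b := by
    intro a b
    have := (hd.hasFDerivAt.clm_apply (hasFDerivAt_const b z)).fderiv
    change fderiv ℝ (fun y => fderiv ℝ f y b) z a = _
    rw [this]
    simp
  rw [h, h]
  exact (hf.isSymmSndFDerivAt (by simp)) a b

theorem dirDeriv_dirDeriv_sum {ι : Type*} (s : Finset ι) (c : ι → ℝ) (e : ι → V)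
    (hf : ContDiffAt ℝ 2 f z) :
    dirDeriv (∑ i ∈ s, c i • e i) (dirDeriv (∑ i ∈ s, c i • e i) f) z =
      ∑ i ∈ s, ∑ j ∈ s, c i * c j * dirDeriv (e i) (dirDeriv (e j) f) z := by
  rw [dirDeriv_sum]
  refine Finset.sum_congr rfl fun i _ => ?_
  rw [dirDeriv_comm hf, dirDeriv_sum, Finset.mul_sum]
  refine Finset.sum_congr rfl fun j _ => ?_
  rw [dirDeriv_comm hf, mul_assoc]

theorem hasDerivAt_comp_line (hf : DifferentiableAt ℝ f z) (a : V) :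
    HasDerivAt (fun s : ℝ => f (z + s • a)) (dirDeriv a f z) 0 := by
  have h1 : HasDerivAt (fun s : ℝ => z + s • a) a 0 := by
    simpa using ((hasDerivAt_id (0 : ℝ)).smul_const a).const_add z
  have h2 : HasFDerivAt f (fderiv ℝ f z) (z + (0 : ℝ) • a) := by
    simpa using hf.hasFDerivAt
  exact h2.comp_hasDerivAt 0 h1

theorem HasDerivAt.dirDeriv_eq {a : V} {d : ℝ} (hf : DifferentiableAt ℝ f z)
    (h : HasDerivAt (fun s : ℝ => f (z + s • a)) d 0) : dirDeriv a f z = d :=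
  (hasDerivAt_comp_line hf a).unique h

theorem dirDeriv_mul (hf : DifferentiableAt ℝ f z) (hg : DifferentiableAt ℝ g z) (a : V) :
    dirDeriv a (fun y => f y * g y) z = f z * dirDeriv a g z + g z * dirDeriv a f z := by
  have := (hf.hasFDerivAt.mul hg.hasFDerivAt).fderiv
  change fderiv ℝ (fun y => f y * g y) z a = _
  change fderiv ℝ (fun y => f y * g y) z = _ at this
  rw [this]
  simp [dirDeriv]

theorem dirDeriv_add (hf : DifferentiableAt ℝ f z) (hg : DifferentiableAt ℝ g z) (a : V) :
    dirDeriv a (fun y => f y + g y) z = dirDeriv a f z + dirDeriv a g z := by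
  simp [dirDeriv, fderiv_fun_add hf hg]

theorem dirDeriv_dirDeriv_mul (hf : ContDiffAt ℝ 2 f z) (hg : ContDiffAt ℝ 2 g z) (a b : V) :
    dirDeriv a (dirDeriv b fun y => f y * g y) z =
      f z * dirDeriv a (dirDeriv b g) z + dirDeriv a f z * dirDeriv b g z
        + dirDeriv b f z * dirDeriv a g z + g z * dirDeriv a (dirDeriv b f) z := by
  have hev : dirDeriv b (fun y => f y * g y) =ᶠ[𝓝 z]
      fun y => f y * dirDeriv b g y + g y * dirDeriv b f y := by
    filter_upwards [hf.eventually (by simp), hg.eventually (by simp)] with y h1 h2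
    exact dirDeriv_mul (h1.differentiableAt (by norm_num)) (h2.differentiableAt (by norm_num)) b
  have df := hf.differentiableAt (by norm_num)
  have dg := hg.differentiableAt (by norm_num)
  have df' := (hf.dirDeriv (m := 1) b (by norm_num)).differentiableAt (by norm_num)
  have dg' := (hg.dirDeriv (m := 1) b (by norm_num)).differentiableAt (by norm_num)
  rw [(hev.dirDeriv a).eq_of_nhds, dirDeriv_add (df.fun_mul dg') (dg.fun_mul df'), dirDeriv_mul df dg',
    dirDeriv_mul dg df']
  ring

theorem dirDeriv_exp_sub_one (hf : DifferentiableAt ℝ f z) (K : ℝ) (a : V) :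
    dirDeriv a (fun y => Real.exp (K * f y) - 1) z =
      K * Real.exp (K * f z) * dirDeriv a f z := by
  have h := ((hf.hasFDerivAt.const_mul K).exp.sub_const 1).fderiv
  change fderiv ℝ (fun y => Real.exp (K * f y) - 1) z a = _
  rw [h]
  simp [dirDeriv]
  ring

theorem dirDeriv_dirDeriv_exp_sub_one (hf : ContDiffAt ℝ 2 f z) (K : ℝ) (a b : V) :
    dirDeriv a (dirDeriv b fun y => Real.exp (K * f y) - 1) z =
      Real.exp (K * f z) * (K * dirDeriv a (dirDeriv b f) z
        + K ^ 2 * (dirDeriv a f z * dirDeriv b f z)) := by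
  have hev : dirDeriv b (fun y => Real.exp (K * f y) - 1) =ᶠ[𝓝 z]
      fun y => ((Real.exp (K * f y) - 1) + 1) * (K * dirDeriv b f y) := by
    filter_upwards [hf.eventually (by simp)] with y h1
    rw [dirDeriv_exp_sub_one (h1.differentiableAt (by norm_num))]
    ring
  have df := hf.differentiableAt (n := 2) (by norm_num)
  have df' := (hf.dirDeriv (m := 1) b (by norm_num)).differentiableAt (by norm_num)
  have d1 : DifferentiableAt ℝ (fun y => Real.exp (K * f y) - 1) z :=
    (df.const_mul K).exp.sub_const 1
  have hc : ∀ (c : ℝ), dirDeriv a (fun _ => c) z = 0 := fun c => by simp [dirDeriv]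
  rw [(hev.dirDeriv a).eq_of_nhds, dirDeriv_mul (d1.add_const 1) (df'.const_mul K),
    dirDeriv_mul (differentiableAt_const K) df', dirDeriv_add d1 (differentiableAt_const 1),
    dirDeriv_exp_sub_one df, hc, hc]
  ring

theorem IsLocalMax.deriv_deriv_nonpos {h : ℝ → ℝ} {x : ℝ} (hm : IsLocalMax h x)
    (hc : ContinuousAt h x) : deriv (deriv h) x ≤ 0 := by
  by_contra! hpos
  have hmin := isLocalMin_of_deriv_deriv_pos hpos hm.deriv_eq_zero hc
  have hconst : h =ᶠ[𝓝 x] fun _ => h x := by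
    filter_upwards [hm, hmin] with y h1 h2
    exact le_antisymm h1 h2
  have := hconst.deriv.deriv_eq
  simp at this
  linarith

theorem dirDeriv_dirDeriv_nonpos (hf : ContDiffAt ℝ 2 f z) (a : V)
    (hm : ∀ᶠ s : ℝ in 𝓝 0, f (z + s • a) ≤ f z) :
    dirDeriv a f z = 0 ∧ dirDeriv a (dirDeriv a f) z ≤ 0 := by
  have hmax : IsLocalMax (fun s : ℝ => f (z + s • a)) 0 := by
    filter_upwards [hm] with s hs
    simpa using hs
  have h1 := hasDerivAt_comp_line (hf.differentiableAt (by norm_num)) a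
  have hcont : Tendsto (fun s : ℝ => z + s • a) (𝓝 0) (𝓝 z) := by
    have : Continuous fun s : ℝ => z + s • a := by fun_prop
    simpa using this.tendsto 0
  have hd : deriv (fun s : ℝ => f (z + s • a)) =ᶠ[𝓝 0] fun s => dirDeriv a f (z + s • a) := by
    filter_upwards [hcont.eventually (hf.eventually (by simp))] with s hs
    have h2 := hasDerivAt_comp_line (hs.differentiableAt (by norm_num)) a
    have h3 : HasDerivAt (fun r : ℝ => r - s) 1 s := (hasDerivAt_id s).sub_const s
    have h4 : HasDerivAt (fun r : ℝ => f (z + s • a + r • a)) (dirDeriv a f (z + s • a)) (s - s) := by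
      simpa using h2
    have h5 := HasDerivAt.comp (h := fun r : ℝ => r - s) s h4 h3
    have h6 : ((fun r : ℝ => f (z + s • a + r • a)) ∘ fun r => r - s) =
        fun r : ℝ => f (z + r • a) := by
      funext r
      simp only [Function.comp, add_assoc, ← add_smul]
      congr 3
      ring
    rw [h6] at h5
    simpa using h5.deriv
  have h2 := hasDerivAt_comp_line
    ((hf.dirDeriv (m := 1) a (by norm_num)).differentiableAt (by norm_num)) a
  refine ⟨hmax.hasDerivAt_eq_zero h1, ?_⟩
  rw [← h2.deriv, ← hd.deriv_eq]
  exact hmax.deriv_deriv_nonpos h1.continuousAt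

theorem dirDeriv_nonneg_of_eventually_le (hf : DifferentiableAt ℝ f z) (a : V)
    (hm : ∀ᶠ s : ℝ in 𝓝[<] 0, f (z + s • a) ≤ f z) : 0 ≤ dirDeriv a f z := by
  have h := (hasDerivAt_comp_line hf a).hasDerivWithinAt (s := Set.Iio 0)
  rw [hasDerivWithinAt_iff_tendsto_slope' (by simp)] at h
  refine ge_of_tendsto h ?_
  filter_upwards [hm, self_mem_nhdsWithin] with s hs hs0
  rw [slope_def_field]
  apply div_nonneg_of_nonpos
  · simpa using hs
  · simpa using (Set.mem_Iio.1 hs0).le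

end dirDeriv

section GraphEquation

variable {V : Type*} [NormedAddCommGroup V] [NormedSpace ℝ V] {n : ℕ} {F : V → ℝ} {z : V}
  {e : Fin n → V} {τ : V} {A : ℝ}

/-- The derivative of a solution in the frozen gradient direction solves the linearized equation. -/
theorem dirDeriv_gradient_direction (hF : ContDiffAt ℝ 3 F z)
    (hE : ∀ᶠ y in 𝓝 z, dirDeriv τ F y =
      mcOp (fun i => dirDeriv (e i) F y) (fun i j => dirDeriv (e i) (dirDeriv (e j) F) y)
        - A * √(1 + ∑ k, dirDeriv (e k) F y ^ 2))
    {q : Fin n → ℝ} (hq : ∀ i, dirDeriv (e i) F z = q i) {P : V → ℝ}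
    (hP : P = dirDeriv (∑ i, q i • e i) F) :
    dirDeriv τ P z = mcOp q (fun i j => dirDeriv (e i) (dirDeriv (e j) P) z)
      - 2 / (1 + ∑ k, q k ^ 2) * mcOp q (fun i j => dirDeriv (e i) P z * dirDeriv (e j) P z)
      - A * (∑ k, q k * dirDeriv (e k) P z) / √(1 + ∑ k, q k ^ 2) := by
  set Q := ∑ i, q i • e i with hQ
  have hF2 : ContDiffAt ℝ 2 F z := hF.of_le (by norm_num)
  have hev : ∀ᶠ y in 𝓝 z, ContDiffAt ℝ 2 F y := hF2.eventually (by simp)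
  have c1 : ∀ a, ContDiffAt ℝ 2 (dirDeriv a F) z := fun a => hF.dirDeriv a (by norm_num)
  have c2 : ∀ a b, ContDiffAt ℝ 1 (dirDeriv a (dirDeriv b F)) z :=
    fun a b => (c1 b).dirDeriv a (by norm_num)
  have hPi : ∀ i, dirDeriv Q (dirDeriv (e i) F) z = dirDeriv (e i) P z := fun i => by
    rw [hP, dirDeriv_comm hF2]
  have hPij : ∀ i j, dirDeriv Q (dirDeriv (e i) (dirDeriv (e j) F)) z =
      dirDeriv (e i) (dirDeriv (e j) P) z := fun i j => by
    rw [dirDeriv_comm (c1 _), hP]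
    refine (Filter.EventuallyEq.dirDeriv ?_ _).eq_of_nhds
    filter_upwards [hev] with y hy using dirDeriv_comm hy _ _
  have hsum : ∀ i, ∑ j, q j * dirDeriv (e i) (dirDeriv (e j) F) z = dirDeriv (e i) P z := fun i => by
    rw [← hPi, hQ, dirDeriv_sum]
    exact Finset.sum_congr rfl fun j _ => by rw [dirDeriv_comm hF2]
  have hsum' : ∀ j, ∑ i, q i * dirDeriv (e i) (dirDeriv (e j) F) z = dirDeriv (e j) P z := fun j => by
    rw [← hPi, hQ, dirDeriv_sum]
  have hW : 0 < 1 + ∑ k, q k ^ 2 := by positivity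
  have hlhs : dirDeriv τ P z = dirDeriv Q (dirDeriv τ F) z := by rw [hP, dirDeriv_comm hF2]
  have d1 : ∀ i, HasDerivAt (fun s : ℝ => dirDeriv (e i) F (z + s • Q)) (dirDeriv (e i) P z) 0 :=
    fun i => hPi i ▸ hasDerivAt_comp_line ((c1 _).differentiableAt (by norm_num)) Q
  have d2 : ∀ i j, HasDerivAt (fun s : ℝ => dirDeriv (e i) (dirDeriv (e j) F) (z + s • Q))
      (dirDeriv (e i) (dirDeriv (e j) P) z) 0 :=
    fun i j => hPij i j ▸ hasDerivAt_comp_line ((c2 _ _).differentiableAt (by norm_num)) Q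
  have dW : HasDerivAt (fun s : ℝ => 1 + ∑ k, dirDeriv (e k) F (z + s • Q) ^ 2)
      (2 * ∑ k, q k * dirDeriv (e k) P z) 0 := by
    have := (HasDerivAt.fun_sum (u := Finset.univ) fun k _ => (d1 k).fun_pow 2).const_add 1
    refine this.congr_deriv ?_
    rw [Finset.mul_sum]
    refine Finset.sum_congr rfl fun k _ => ?_
    simp [hq]
    ring
  have hW0 : 1 + ∑ k, dirDeriv (e k) F (z + (0 : ℝ) • Q) ^ 2 = 1 + ∑ k, q k ^ 2 := by
    simp [hq]
  have dM := HasDerivAt.fun_sum (u := Finset.univ) fun i _ =>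
    HasDerivAt.fun_sum (u := Finset.univ) fun j _ =>
      (((((d1 i).fun_mul (d1 j)).fun_div dW (by rw [hW0]; exact hW.ne')).const_sub
        (if i = j then (1 : ℝ) else 0)).fun_mul (d2 i j))
  have dS := (dW.sqrt (by rw [hW0]; exact hW.ne')).const_mul A
  have dR := dM.fun_sub dS
  have hcont : Tendsto (fun s : ℝ => z + s • Q) (𝓝 0) (𝓝 z) := by
    have : Continuous fun s : ℝ => z + s • Q := by fun_prop
    simpa using this.tendsto 0
  have dL := dR.congr_of_eventuallyEq (hcont.eventually hE)
  rw [hlhs, HasDerivAt.dirDeriv_eq ((c1 τ).differentiableAt (by norm_num)) dL]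
  simp only [zero_smul, add_zero, hq]
  set W := 1 + ∑ k, q k ^ 2 with hWdef
  set R := ∑ k, q k * dirDeriv (e k) P z with hR
  have hs : A * (2 * R / (2 * √W)) = A * R / √W := by
    have := Real.sqrt_pos.2 hW
    field_simp
  rw [hs, mcOp_outer]
  congr 1
  rw [← hR, ← hWdef]
  have hB1 : ∑ i, ∑ j, dirDeriv (e i) P z * q j * dirDeriv (e i) (dirDeriv (e j) F) z =
      ∑ i, dirDeriv (e i) P z * dirDeriv (e i) P z := by
    refine Finset.sum_congr rfl fun i _ => ?_
    simp only [mul_assoc, ← Finset.mul_sum, hsum]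
  have hB2 : ∑ i, ∑ j, q i * dirDeriv (e j) P z * dirDeriv (e i) (dirDeriv (e j) F) z =
      ∑ i, dirDeriv (e i) P z * dirDeriv (e i) P z := by
    rw [Finset.sum_comm]
    refine Finset.sum_congr rfl fun j _ => ?_
    have : dirDeriv (e j) P z * dirDeriv (e j) P z =
      dirDeriv (e j) P z * ∑ i, q i * dirDeriv (e i) (dirDeriv (e j) F) z := by rw [hsum']
    rw [this, Finset.mul_sum]
    exact Finset.sum_congr rfl fun i _ => by ring
  have hB3 : ∑ i, ∑ j, q i * q j * dirDeriv (e i) (dirDeriv (e j) F) z = R := by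
    rw [hR]
    refine Finset.sum_congr rfl fun i _ => ?_
    rw [← hsum i, Finset.mul_sum]
    exact Finset.sum_congr rfl fun j _ => by ring
  have hterm : ∀ i j, -(((dirDeriv (e i) P z * q j + q i * dirDeriv (e j) P z) * W
        - q i * q j * (2 * R)) / W ^ 2) * dirDeriv (e i) (dirDeriv (e j) F) z
        + ((if i = j then (1 : ℝ) else 0) - q i * q j / W) * dirDeriv (e i) (dirDeriv (e j) P) z
      = ((if i = j then (1 : ℝ) else 0) - q i * q j / W) * dirDeriv (e i) (dirDeriv (e j) P) z
        - 1 / W * (dirDeriv (e i) P z * q j * dirDeriv (e i) (dirDeriv (e j) F) z)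
        - 1 / W * (q i * dirDeriv (e j) P z * dirDeriv (e i) (dirDeriv (e j) F) z)
        + 2 * R / W ^ 2 * (q i * q j * dirDeriv (e i) (dirDeriv (e j) F) z) := by
    intro i j
    field_simp
    ring
  simp only [hterm, Finset.sum_add_distrib, Finset.sum_sub_distrib, ← Finset.mul_sum, hB1, hB2, hB3]
  simp only [mcOp, ← hWdef]
  generalize ∑ i, ∑ j, ((if i = j then (1 : ℝ) else 0) - q i * q j / W) *
    dirDeriv (e i) (dirDeriv (e j) P) z = X
  field_simp
  ring

/-- The differential inequality for `φ` at a maximum of `(exp (K φ) - 1) √(1 + |∇F|²)`. -/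
theorem cutoff_inequality_of_isMax (hF : ContDiffAt ℝ 3 F z)
    (hE : ∀ᶠ y in 𝓝 z, dirDeriv τ F y =
      mcOp (fun i => dirDeriv (e i) F y) (fun i j => dirDeriv (e i) (dirDeriv (e j) F) y)
        - A * √(1 + ∑ k, dirDeriv (e k) F y ^ 2))
    {q : Fin n → ℝ} (hq : ∀ i, dirDeriv (e i) F z = q i)
    {φ : V → ℝ} (hφ : ContDiffAt ℝ 2 φ z) {K : ℝ} (hK : 0 < K) (hφ0 : 0 < φ z)
    {N : Set V}
    (hmax : ∀ᶠ y in 𝓝[N] z, (Real.exp (K * φ y) - 1) * √(1 + ∑ k, dirDeriv (e k) F y ^ 2) ≤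
      (Real.exp (K * φ z) - 1) * √(1 + ∑ k, dirDeriv (e k) F z ^ 2))
    (hspace : ∀ (ξ : Fin n → ℝ) (s : ℝ), z + s • ∑ i, ξ i • e i ∈ N)
    (htime : ∀ s < (0 : ℝ), z + s • τ ∈ N) :
    K * mcOp q (fun i j => dirDeriv (e i) φ z * dirDeriv (e j) φ z) ≤
      dirDeriv τ φ z - mcOp q (fun i j => dirDeriv (e i) (dirDeriv (e j) φ) z)
        + A * (∑ k, q k * dirDeriv (e k) φ z) / √(1 + ∑ k, q k ^ 2) := by
  set P := dirDeriv (∑ i, q i • e i) F with hP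
  have hlin := dirDeriv_gradient_direction hF hE hq hP
  set W := 1 + ∑ k, q k ^ 2 with hW
  have hW0 : 0 < W := by positivity
  have hPsum : ∀ y, P y = ∑ i, q i * dirDeriv (e i) F y := fun y => by rw [hP, dirDeriv_sum]
  have hPz : 1 + P z = W := by
    rw [hPsum, hW]
    congr 1
    exact Finset.sum_congr rfl fun i _ => by rw [hq, sq]
  have cP : ContDiffAt ℝ 2 P z := hF.dirDeriv _ (by norm_num)
  set η : V → ℝ := fun y => Real.exp (K * φ y) - 1 with hη
  have cη : ContDiffAt ℝ 2 η z := by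
    rw [hη]
    exact (Real.contDiff_exp.contDiffAt.comp z (contDiffAt_const.mul hφ)).sub contDiffAt_const
  have hηz : 0 < η z := by
    simp only [hη, sub_pos, Real.one_lt_exp_iff]
    positivity
  have cℓ : ContDiffAt ℝ 2 (fun y => 1 + P y) z := contDiffAt_const.add cP
  have cg : ContDiffAt ℝ 2 (fun y => η y * (1 + P y)) z := cη.mul cℓ
  have hgmax : ∀ᶠ y in 𝓝[N] z, η y * (1 + P y) ≤ η z * (1 + P z) := by
    have hηpos : ∀ᶠ y in 𝓝[N] z, 0 < η y :=
      (cη.continuousAt.eventually (lt_mem_nhds hηz)).filter_mono nhdsWithin_le_nhds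
    filter_upwards [hmax, hηpos] with y hy hy0
    have hcs : 1 + P y ≤ √W * √(1 + ∑ k, dirDeriv (e k) F y ^ 2) := by
      rw [← Real.sqrt_mul hW0.le]
      apply Real.le_sqrt_of_sq_le
      rw [hPsum]
      have h1 := Finset.sum_mul_sq_le_sq_mul_sq Finset.univ q fun i => dirDeriv (e i) F y
      have h2 : 0 ≤ ∑ i, (q i - dirDeriv (e i) F y) ^ 2 := by positivity
      have h3 : ∑ i, (q i - dirDeriv (e i) F y) ^ 2 = ∑ i, q i ^ 2
          - 2 * ∑ i, q i * dirDeriv (e i) F y + ∑ i, dirDeriv (e i) F y ^ 2 := by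
        rw [Finset.mul_sum, ← Finset.sum_sub_distrib, ← Finset.sum_add_distrib]
        exact Finset.sum_congr rfl fun i _ => by ring
      rw [hW]
      nlinarith
    have hWz : 1 + ∑ k, dirDeriv (e k) F z ^ 2 = W := by simp only [hq, hW]
    rw [hWz] at hy
    calc η y * (1 + P y) ≤ η y * (√W * √(1 + ∑ k, dirDeriv (e k) F y ^ 2)) := by gcongr
      _ = √W * (η y * √(1 + ∑ k, dirDeriv (e k) F y ^ 2)) := by ring
      _ ≤ √W * (η z * √W) := by gcongr
      _ = η z * (1 + P z) := by
        rw [hPz, mul_left_comm, Real.mul_self_sqrt hW0.le]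
  have hline : ∀ a : V, Tendsto (fun s : ℝ => z + s • a) (𝓝 0) (𝓝 z) := fun a => by
    have : Continuous fun s : ℝ => z + s • a := by fun_prop
    simpa using this.tendsto 0
  have hsp : ∀ ξ : Fin n → ℝ, dirDeriv (∑ i, ξ i • e i) (fun y => η y * (1 + P y)) z = 0 ∧
      dirDeriv (∑ i, ξ i • e i) (dirDeriv (∑ i, ξ i • e i) fun y => η y * (1 + P y)) z ≤ 0 := by
    intro ξ
    refine dirDeriv_dirDeriv_nonpos cg _ ?_
    exact (tendsto_nhdsWithin_iff.2 ⟨hline _, .of_forall (hspace ξ)⟩).eventually hgmax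
  have htm : 0 ≤ dirDeriv τ (fun y => η y * (1 + P y)) z := by
    refine dirDeriv_nonneg_of_eventually_le (cg.differentiableAt (by norm_num)) _ ?_
    refine (tendsto_nhdsWithin_iff.2 ⟨(hline τ).mono_left nhdsWithin_le_nhds, ?_⟩).eventually hgmax
    filter_upwards [self_mem_nhdsWithin] with s hs using htime s hs
  have hM : mcOp q (fun i j => dirDeriv (e i) (dirDeriv (e j) fun y => η y * (1 + P y)) z) ≤ 0 := by
    refine mcOp_nonpos q _ fun ξ => ?_
    rw [← dirDeriv_dirDeriv_sum _ _ _ cg]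
    exact (hsp ξ).2
  have dη := cη.differentiableAt (by norm_num)
  have dℓ := cℓ.differentiableAt (by norm_num)
  have hc : ∀ (a y : V), dirDeriv a (fun _ => (1 : ℝ)) y = 0 := fun a y => by simp [dirDeriv]
  have hℓ1 : ∀ a, dirDeriv a (fun y => 1 + P y) =ᶠ[𝓝 z] dirDeriv a P := fun a => by
    filter_upwards [cP.eventually (by simp)] with y hy
    rw [dirDeriv_add (differentiableAt_const _) (hy.differentiableAt (by norm_num)), hc, zero_add]
  have hℓ2 : ∀ a b, dirDeriv a (dirDeriv b (fun y => 1 + P y)) z = dirDeriv a (dirDeriv b P) z :=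
    fun a b => ((hℓ1 b).dirDeriv a).eq_of_nhds
  have hgrad : ∀ i, η z * dirDeriv (e i) P z = - (W * dirDeriv (e i) η z) := fun i => by
    have h := (hsp (Pi.single i 1)).1
    rw [show ∑ j, (Pi.single i 1 : Fin n → ℝ) j • e j = e i by
      simp [Pi.single_apply], dirDeriv_mul dη dℓ, (hℓ1 _).eq_of_nhds, hPz] at h
    linarith
  rw [dirDeriv_mul dη dℓ, (hℓ1 _).eq_of_nhds, hPz, hlin] at htm
  have hMexp : mcOp q (fun i j => dirDeriv (e i) (dirDeriv (e j) fun y => η y * (1 + P y)) z) =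
      η z * mcOp q (fun i j => dirDeriv (e i) (dirDeriv (e j) P) z)
      + mcOp q (fun i j => dirDeriv (e i) η z * dirDeriv (e j) P z)
      + mcOp q (fun i j => dirDeriv (e i) P z * dirDeriv (e j) η z)
      + W * mcOp q (fun i j => dirDeriv (e i) (dirDeriv (e j) η) z) := by
    have hcomm : mcOp q (fun i j => dirDeriv (e i) P z * dirDeriv (e j) η z) =
        mcOp q fun i j => dirDeriv (e j) η z * dirDeriv (e i) P z := by
      congr 1
      funext i j
      ring
    rw [hcomm]
    simp only [dirDeriv_dirDeriv_mul cη cℓ, hℓ2, (hℓ1 _).eq_of_nhds, hPz, mcOp_add, mcOp_mul_left]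
  rw [hMexp] at hM
  set E := Real.exp (K * φ z) with hEdef
  have hE0 : 0 < E := Real.exp_pos _
  have dφ := hφ.differentiableAt (by norm_num)
  have hη1 : ∀ a, dirDeriv a η z = K * E * dirDeriv a φ z := fun a => dirDeriv_exp_sub_one dφ K a
  have hη2 : mcOp q (fun i j => dirDeriv (e i) (dirDeriv (e j) η) z) =
      E * (K * mcOp q (fun i j => dirDeriv (e i) (dirDeriv (e j) φ) z)
        + K ^ 2 * mcOp q (fun i j => dirDeriv (e i) φ z * dirDeriv (e j) φ z)) := by
    simp only [hη, dirDeriv_dirDeriv_exp_sub_one hφ, mcOp_mul_left, mcOp_add, hEdef]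
  have hη3 : ∀ i, dirDeriv (e i) P z = - (W * K * E / η z) * dirDeriv (e i) φ z := fun i => by
    have := hgrad i
    rw [hη1] at this
    field_simp
    linarith
  set a := mcOp q (fun i j => dirDeriv (e i) φ z * dirDeriv (e j) φ z) with ha
  have hout : ∀ c d : ℝ, mcOp q (fun i j => (c * dirDeriv (e i) φ z) * (d * dirDeriv (e j) φ z)) =
      c * d * a := fun c d => by
    rw [ha, ← mcOp_mul_left]
    congr 1
    funext i j
    ring
  have hqP : ∑ k, q k * dirDeriv (e k) P z =
      - (W * K * E / η z) * ∑ k, q k * dirDeriv (e k) φ z := by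
    rw [Finset.mul_sum]
    exact Finset.sum_congr rfl fun k _ => by rw [hη3]; ring
  rw [hqP] at htm
  simp only [hη3, hη1, hout] at htm
  rw [hη2] at hM
  simp only [hη3, hη1, hout] at hM
  set S := ∑ k, q k * dirDeriv (e k) φ z
  set L := mcOp q (fun i j => dirDeriv (e i) (dirDeriv (e j) P) z)
  set Lφ := mcOp q (fun i j => dirDeriv (e i) (dirDeriv (e j) φ) z)
  have hsq : 0 < √W := Real.sqrt_pos.2 hW0
  have hfin : 0 ≤ W * K * E * (dirDeriv τ φ z - Lφ + A * S / √W - K * a) := by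
    have e1 : η z * (L - 2 / W * (-(W * K * E / η z) * -(W * K * E / η z) * a)
        - A * (-(W * K * E / η z) * S) / √W) =
        η z * L - 2 * (W * K * E * (K * E)) * a / η z + A * (W * K * E) * S / √W := by
      field_simp
      ring
    have e2 : K * E * -(W * K * E / η z) * a + -(W * K * E / η z) * (K * E) * a =
      - (2 * (W * K * E * (K * E)) * a / η z) := by ring
    have e3 : W * K * E * (A * S / √W) = A * (W * K * E) * S / √W := by ring
    nlinarith
  have := nonneg_of_mul_nonneg_right hfin (by positivity)
  linarith

end GraphEquation

/-- The lower bound on the constant `K` turns the differential inequality for the cutoff into a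
gradient bound at the maximum point. -/
theorem sqrt_sum_sq_lt_of_cutoff_inequality {n : ℕ} {A T v₀ L ρ κ K : ℝ} {q X : Fin n → ℝ}
    (hA : 0 < A) (hT : 0 < T) (hv₀ : 0 < v₀) (hρ0 : 0 ≤ ρ) (hρ1 : ρ ≤ 1) (hκ : κ ≤ 1 / T)
    (hX : ∑ i, X i ^ 2 ≤ 4)
    (hK : K = 20 * v₀ ^ 2 * (4 * (n : ℝ) + 1 / T + 4 * A + A / (2 * v₀)) + 2)
    (h : K * mcOp q (fun i j => (-(1 / (2 * v₀)) * q i + X i) * (-(1 / (2 * v₀)) * q j + X j)) ≤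
      (-(1 / (2 * v₀)) * (L - A * √(1 + ∑ k, q k ^ 2)) + κ)
        - (-(1 / (2 * v₀)) * L + -(2 * ρ) * mcOp q (fun i j => if i = j then (1 : ℝ) else 0))
        + A * (∑ k, q k * (-(1 / (2 * v₀)) * q k + X k)) / √(1 + ∑ k, q k ^ 2)) :
    √(∑ i, q i ^ 2) < 3 + 16 * v₀ := by
  by_contra! hr
  set r := √(∑ i, q i ^ 2) with hrdef
  have hr2 : ∑ i, q i ^ 2 = r ^ 2 := (Real.sq_sqrt (by positivity)).symm
  have hr0 : 0 < r := by linarith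
  set b := ∑ i, q i * X i with hb
  have hX0 : 0 ≤ ∑ i, X i ^ 2 := by positivity
  have hbb : b ^ 2 ≤ r ^ 2 * ∑ i, X i ^ 2 := by
    rw [← hr2]
    exact Finset.sum_mul_sq_le_sq_mul_sq _ _ _
  have hb2 : |b| ≤ 2 * r := by
    apply abs_le_of_sq_le_sq _ (by positivity)
    nlinarith
  obtain ⟨hb3, hb4⟩ := abs_le.1 hb2
  have htr := mcOp_one_le q
  set w := √(1 + ∑ k, q k ^ 2) with hw
  have hw0 : 0 < w := Real.sqrt_pos.2 (by positivity)
  have hww : w ^ 2 = 1 + r ^ 2 := by rw [hw, Real.sq_sqrt (by positivity), hr2]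
  set c := 1 / (2 * v₀) with hc
  have hc0 : 0 < c := by positivity
  have hcv : c * v₀ = 1 / 2 := by rw [hc]; field_simp
  have hqG : ∑ k, q k * (-c * q k + X k) = -c * r ^ 2 + b := by
    rw [← hr2, hb, Finset.mul_sum, ← Finset.sum_add_distrib]
    exact Finset.sum_congr rfl fun k _ => by ring
  have hGG : ∑ k, (-c * q k + X k) * (-c * q k + X k) =
      c ^ 2 * r ^ 2 - 2 * c * b + ∑ i, X i ^ 2 := by
    rw [← hr2, hb, Finset.mul_sum, Finset.mul_sum, ← Finset.sum_sub_distrib,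
      ← Finset.sum_add_distrib]
    exact Finset.sum_congr rfl fun k _ => by ring
  rw [mcOp_outer, hqG, hGG, hr2] at h
  set M := 4 * (n : ℝ) + 1 / T + 4 * A + A / (2 * v₀) with hM
  have hM0 : 0 < M := by positivity
  have hlow : 1 / (10 * v₀ ^ 2) ≤ c ^ 2 * r ^ 2 - 2 * c * b + ∑ i, X i ^ 2
      - (-c * r ^ 2 + b) * (-c * r ^ 2 + b) / (1 + r ^ 2) := by
    have hv : 1 / (10 * v₀ ^ 2) = 2 / 5 * c ^ 2 := by
      rw [hc]
      field_simp
      norm_num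
    have hrc : 8 ≤ r * c := by
      have : 16 * v₀ * c ≤ r * c := by gcongr; linarith
      linarith
    rw [hv, le_sub_iff_add_le, ← le_sub_iff_add_le', div_le_iff₀ (by positivity)]
    have h9 : 3 ^ 2 ≤ r ^ 2 := by gcongr; linarith
    have h1 : 8 * (r * c) ≤ r * c * (r * c) := by gcongr
    have h2 : 2 * c * b ≤ 2 * c * (2 * r) := by gcongr
    have h3 : c ^ 2 * (1 + r ^ 2) ≤ c ^ 2 * (10 / 9 * r ^ 2) := by gcongr; linarith
    have h4 : 0 ≤ c ^ 2 * r ^ 2 := by positivity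
    linarith
  have hKpos : 0 < K := by rw [hK]; positivity
  have hlhs : 2 * M ≤ K * (1 / (10 * v₀ ^ 2)) := by
    rw [hK, mul_one_div, le_div_iff₀ (by positivity)]
    linarith
  have hup : A * (-c * r ^ 2 + b) / w ≤ -c * (A * w) + A * c + 2 * A := by
    rw [div_le_iff₀ hw0]
    have hrw : r ≤ w := abs_le_of_sq_le_sq' (by linarith) hw0.le |>.2
    have hw1 : 1 ≤ w := Real.one_le_sqrt.2 (le_add_of_nonneg_right (by positivity))
    have h5 : A * b ≤ A * (2 * w) := by gcongr; linarith
    have h6 : A * c * 1 ≤ A * c * w := by gcongr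
    have h7 : c * A * w ^ 2 = c * A * (1 + r ^ 2) := by rw [hww]
    have h8 : (-c * (A * w) + A * c + 2 * A) * w =
      -(c * A * w ^ 2) + A * c * w + A * (2 * w) := by ring
    rw [h8]
    linarith
  have hAc : A * c = A / (2 * v₀) := by rw [hc]; ring
  have htr' : 2 * ρ * mcOp q (fun i j => if i = j then (1 : ℝ) else 0) ≤ 2 * n := by
    have : ρ * mcOp q (fun i j => if i = j then (1 : ℝ) else 0) ≤ 1 * n := by
      calc _ ≤ ρ * (n : ℝ) := by gcongr
        _ ≤ 1 * n := by gcongr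
    linarith
  have := mul_le_mul_of_nonneg_left hlow hKpos.le
  have hn : (0 : ℝ) ≤ n := n.cast_nonneg
  have hT' : 0 < 1 / T := by positivity
  linarith

/-- Passing from the bound at the maximum point to the bound at the centre. -/
theorem le_mul_exp_of_max_comparison {K c s r m : ℝ} (hK : 2 ≤ K) (hc : 3 ≤ c) (hr0 : 0 ≤ r)
    (hr : r ≤ c) (hm : m ≤ 3 / 4)
    (h : (Real.exp (K * (1 / 4)) - 1) * √(1 + s ^ 2) ≤ (Real.exp (K * m) - 1) * √(1 + r ^ 2)) :
    s ≤ c * Real.exp (2 * K) := by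
  set y := Real.exp (K * (1 / 4)) with hy
  have hy1 : 3 / 2 ≤ y := by
    have := Real.add_one_le_exp (K * (1 / 4))
    linarith
  have h8 : Real.exp (2 * K) = y ^ 8 := by
    rw [hy, ← Real.exp_nat_mul]
    congr 1
    push_cast
    ring
  have h3 : Real.exp (K * m) ≤ y ^ 3 := by
    rw [hy, ← Real.exp_nat_mul]
    rw [Real.exp_le_exp]
    push_cast
    nlinarith
  have hsqrt : √(1 + r ^ 2) ≤ 10 / 9 * c := by
    rw [Real.sqrt_le_left (by positivity)]
    nlinarith
  have hs : s ≤ √(1 + s ^ 2) := Real.le_sqrt_of_sq_le (by linarith)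
  have h4 : (y - 1) * √(1 + s ^ 2) ≤ (y - 1) * ((y ^ 2 + y + 1) * (10 / 9 * c)) := by
    calc _ ≤ (Real.exp (K * m) - 1) * √(1 + r ^ 2) := h
      _ ≤ (y ^ 3 - 1) * √(1 + r ^ 2) := by gcongr
      _ ≤ (y ^ 3 - 1) * (10 / 9 * c) := by
        have : 1 ≤ y ^ 3 := one_le_pow₀ (by linarith)
        gcongr
      _ = _ := by ring
  have h5 := le_of_mul_le_mul_left h4 (by linarith)
  have h6 : (y ^ 2 + y + 1) * (10 / 9) ≤ y ^ 8 := by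
    have hy6 : (3 / 2 : ℝ) ^ 6 ≤ y ^ 6 := by gcongr
    have hy2 : (3 / 2 : ℝ) ^ 2 ≤ y ^ 2 := by gcongr
    have : y ^ 8 = y ^ 6 * y ^ 2 := by ring
    nlinarith
  rw [h8]
  calc s ≤ (y ^ 2 + y + 1) * (10 / 9) * c := by linarith
    _ ≤ y ^ 8 * c := by gcongr
    _ = c * y ^ 8 := mul_comm _ _

section Cutoff

variable {n : ℕ} (T : ℝ)

/-- The space-time cutoff `(t / T) (1 - |x|²) - 1 / 4`. -/
noncomputable def parabolicCutoff (p : EuclideanSpace ℝ (Fin n) × ℝ) : ℝ :=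
  p.2 / T * (1 - ∑ k, p.1 k ^ 2) - 1 / 4

theorem contDiff_parabolicCutoff {m : WithTop ℕ∞} :
    ContDiff ℝ m (parabolicCutoff (n := n) T) := by
  have : ∀ k, ContDiff ℝ m fun p : EuclideanSpace ℝ (Fin n) × ℝ => p.1 k := fun k =>
    (contDiff_piLp_apply 2).comp contDiff_fst
  unfold parabolicCutoff
  fun_prop

theorem dirDeriv_parabolicCutoff (a p : EuclideanSpace ℝ (Fin n) × ℝ) :
    dirDeriv a (parabolicCutoff T) p =
      a.2 / T * (1 - ∑ k, p.1 k ^ 2) - p.2 / T * ∑ k, 2 * p.1 k * a.1 k := by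
  apply HasDerivAt.dirDeriv_eq
    ((contDiff_parabolicCutoff (m := 1) T).differentiable (by norm_num) p)
  have hl : ∀ c d : ℝ, HasDerivAt (fun s : ℝ => c + s * d) d 0 := fun c d => by
    simpa using ((hasDerivAt_id (0 : ℝ)).mul_const d).const_add c
  have h := ((((hl p.2 a.2).div_const T).fun_mul ((HasDerivAt.fun_sum (u := Finset.univ)
    fun k _ => (hl (p.1 k) (a.1 k)).fun_pow 2).const_sub 1)).sub_const (1 / 4))
  refine h.congr_deriv ?_
  simp
  ring

theorem dirDeriv_single_parabolicCutoff (i : Fin n) :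
    dirDeriv (EuclideanSpace.single i 1, 0) (parabolicCutoff T) =
      fun p => -(2 * (p.2 / T)) * p.1 i := by
  funext p
  rw [dirDeriv_parabolicCutoff]
  simp
  ring

theorem dirDeriv_dirDeriv_single_parabolicCutoff (i j : Fin n)
    (p : EuclideanSpace ℝ (Fin n) × ℝ) :
    dirDeriv (EuclideanSpace.single i 1, 0)
      (dirDeriv (EuclideanSpace.single j 1, 0) (parabolicCutoff T)) p =
      -(2 * (p.2 / T)) * if i = j then (1 : ℝ) else 0 := by
  have hd := (((contDiff_parabolicCutoff (n := n) (m := 2) T).contDiffAt (x := p)).dirDeriv (m := 1)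
    (EuclideanSpace.single j 1, 0) (by norm_num)).differentiableAt (by norm_num)
  apply HasDerivAt.dirDeriv_eq hd
  rw [dirDeriv_single_parabolicCutoff]
  have hl : ∀ c d : ℝ, HasDerivAt (fun s : ℝ => c + s * d) d 0 := fun c d => by
    simpa using ((hasDerivAt_id (0 : ℝ)).mul_const d).const_add c
  have h := (hl (p.1 j) (if i = j then (1 : ℝ) else 0)).const_mul (-(2 * (p.2 / T)))
  refine h.congr_of_eventuallyEq (.of_forall fun s => ?_)
  simp [eq_comm]

end Cutoff

section Partials

variable {n : ℕ} {u : EuclideanSpace ℝ (Fin n) → ℝ → ℝ} {x : EuclideanSpace ℝ (Fin n)} {t : ℝ}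

theorem fderiv_slice_eq_dirDeriv {g : EuclideanSpace ℝ (Fin n) × ℝ → ℝ}
    (hg : DifferentiableAt ℝ g (x, t)) (a : EuclideanSpace ℝ (Fin n)) :
    fderiv ℝ (fun y => g (y, t)) x a = dirDeriv (a, 0) g (x, t) := by
  have h := HasFDerivAt.comp (g := g) (f := fun y => (y, t)) x hg.hasFDerivAt
    (hasFDerivAt_prodMk_left (𝕜 := ℝ) x t)
  have h' := h.fderiv
  change fderiv ℝ (fun y => g (y, t)) x = _ at h'
  rw [h']
  simp [dirDeriv]

theorem pd_eq_dirDeriv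
    (hu : DifferentiableAt ℝ (fun p : EuclideanSpace ℝ (Fin n) × ℝ => u p.1 p.2) (x, t))
    (i : Fin n) :
    pd u t x i = dirDeriv (EuclideanSpace.single i 1, 0) (fun p => u p.1 p.2) (x, t) :=
  fderiv_slice_eq_dirDeriv hu _

theorem pd2_eq_dirDeriv
    (hu : ContDiffAt ℝ 2 (fun p : EuclideanSpace ℝ (Fin n) × ℝ => u p.1 p.2) (x, t))
    (i j : Fin n) :
    pd2 u t x i j = dirDeriv (EuclideanSpace.single i 1, 0)
      (dirDeriv (EuclideanSpace.single j 1, 0) fun p => u p.1 p.2) (x, t) := by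
  rw [← fderiv_slice_eq_dirDeriv
    ((hu.dirDeriv (m := 1) _ (by norm_num)).differentiableAt (by norm_num))]
  have hev : (fun y => pd u t y j) =ᶠ[𝓝 x] fun y =>
      dirDeriv (EuclideanSpace.single j 1, 0) (fun p => u p.1 p.2) (y, t) := by
    have hc : Tendsto (fun y => (y, t)) (𝓝 x) (𝓝 (x, t)) :=
      (Continuous.prodMk_left t).tendsto x
    filter_upwards [hc.eventually (hu.eventually (by simp))] with y hy
    exact pd_eq_dirDeriv (hy.differentiableAt (by norm_num)) j
  rw [pd2, hev.fderiv_eq]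

theorem deriv_slice_eq_dirDeriv
    (hu : DifferentiableAt ℝ (fun p : EuclideanSpace ℝ (Fin n) × ℝ => u p.1 p.2) (x, t)) :
    deriv (fun s => u x s) t = dirDeriv (0, 1) (fun p => u p.1 p.2) (x, t) := by
  have h := HasFDerivAt.comp_hasDerivAt t hu.hasFDerivAt
    ((hasDerivAt_const t x).prodMk (hasDerivAt_id t))
  exact h.deriv

end Partials

/-- one-sided interior gradient estimate, driving force downward, `u > 0`,
`u(0,T) = v₀`: then `|∇u(0,T)| ≤ (3 + 16v₀)·e^{2K}` with
`K = 20v₀²(4n + 1/T + 4A + A/(2v₀)) + 2`. -/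
theorem gradient_estimate_positive (n : ℕ) (hn : 1 ≤ n) (A T v₀ : ℝ)
    (hA : 0 < A) (hT : 0 < T) (hv₀ : 0 < v₀)
    (u : EuclideanSpace ℝ (Fin n) → ℝ → ℝ)
    (hC3 : ContDiffOn ℝ 3 (fun p : EuclideanSpace ℝ (Fin n) × ℝ => u p.1 p.2)
      (Metric.ball (0 : EuclideanSpace ℝ (Fin n)) 1 ×ˢ Set.Ioo (0 : ℝ) (2 * T)))
    (hC0 : ContinuousOn (fun p : EuclideanSpace ℝ (Fin n) × ℝ => u p.1 p.2)
      (closure (Metric.ball (0 : EuclideanSpace ℝ (Fin n)) 1 ×ˢ Set.Ioo (0 : ℝ) (2 * T))))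
    (hpos : ∀ x t, (x, t) ∈
        Metric.ball (0 : EuclideanSpace ℝ (Fin n)) 1 ×ˢ Set.Ioo (0 : ℝ) (2 * T) → 0 < u x t)
    (hval : u 0 T = v₀)
    (hPDE : ∀ x t, (x, t) ∈
        Metric.ball (0 : EuclideanSpace ℝ (Fin n)) 1 ×ˢ Set.Ioo (0 : ℝ) (2 * T) →
      deriv (fun s => u x s) t =
        (∑ i, ∑ j, ((if i = j then (1 : ℝ) else 0)
            - pd u t x i * pd u t x j / (1 + ∑ k, (pd u t x k) ^ 2)) * pd2 u t x i j)
          - A * Real.sqrt (1 + ∑ k, (pd u t x k) ^ 2)) :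
    Real.sqrt (∑ i, (pd u T 0 i) ^ 2) ≤
      (3 + 16 * v₀) *
        Real.exp (2 * (20 * v₀ ^ 2 * (4 * (n : ℝ) + 1 / T + 4 * A + A / (2 * v₀)) + 2)) := by
  set O := Metric.ball (0 : EuclideanSpace ℝ (Fin n)) 1 ×ˢ Set.Ioo (0 : ℝ) (2 * T) with hO
  set F : EuclideanSpace ℝ (Fin n) × ℝ → ℝ := fun p => u p.1 p.2 with hF
  set e : Fin n → EuclideanSpace ℝ (Fin n) × ℝ := fun i => (EuclideanSpace.single i 1, 0) with he
  set K := 20 * v₀ ^ 2 * (4 * (n : ℝ) + 1 / T + 4 * A + A / (2 * v₀)) + 2 with hK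
  have hK2 : 2 ≤ K := by
    rw [hK]
    exact le_add_of_nonneg_left (by positivity)
  have hOo : IsOpen O := Metric.isOpen_ball.prod isOpen_Ioo
  have cF : ∀ p ∈ O, ContDiffAt ℝ 3 F p := fun p hp => hC3.contDiffAt (hOo.mem_nhds hp)
  have dF : ∀ p ∈ O, DifferentiableAt ℝ F p := fun p hp =>
    (cF p hp).differentiableAt (by norm_num)
  have hE : ∀ p ∈ O, dirDeriv (0, 1) F p =
      mcOp (fun i => dirDeriv (e i) F p) (fun i j => dirDeriv (e i) (dirDeriv (e j) F) p)
        - A * √(1 + ∑ k, dirDeriv (e k) F p ^ 2) := by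
    rintro ⟨x, t⟩ hp
    have h := hPDE x t hp
    simp only [pd_eq_dirDeriv (dF _ hp), deriv_slice_eq_dirDeriv (dF _ hp),
      pd2_eq_dirDeriv ((cF _ hp).of_le (by norm_num))] at h
    exact h
  set φ : EuclideanSpace ℝ (Fin n) × ℝ → ℝ :=
    fun p => -(1 / (2 * v₀)) * F p + parabolicCutoff T p with hφ
  set C := {p : EuclideanSpace ℝ (Fin n) × ℝ | 0 ≤ parabolicCutoff T p} ∩
    (Metric.closedBall 0 1 ×ˢ Set.Icc 0 T) with hC
  have hCc : IsCompact C :=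
    ((isCompact_closedBall 0 1).prod isCompact_Icc).inter_left
      (isClosed_le continuous_const (contDiff_parabolicCutoff (m := 0) T).continuous)
  have hnorm : ∀ x : EuclideanSpace ℝ (Fin n), ∑ k, x k ^ 2 = ‖x‖ ^ 2 := fun x =>
    (EuclideanSpace.real_norm_sq_eq x).symm
  have hCO : C ⊆ O := by
    rintro ⟨x, t⟩ ⟨h1, h2, h3, h4⟩
    simp only [parabolicCutoff, Set.mem_ofPred_eq, hnorm] at h1
    simp only [mem_closedBall_zero_iff] at h2
    simp only at h3 h4
    refine ⟨?_, ?_, by simp only; linarith⟩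
    · rw [mem_ball_zero_iff]
      refine lt_of_le_of_ne h2 fun hx => ?_
      simp only at hx
      rw [hx] at h1
      norm_num at h1
    · refine lt_of_le_of_ne h3 fun ht => ?_
      simp only at ht
      rw [← ht] at h1
      norm_num at h1
  have cφ : ∀ p ∈ O, ContDiffAt ℝ 2 φ p := fun p hp =>
    (contDiffAt_const.mul ((cF p hp).of_le (by norm_num))).add
      (contDiff_parabolicCutoff T).contDiffAt
  set w : EuclideanSpace ℝ (Fin n) × ℝ → ℝ :=
    fun p => (Real.exp (K * φ p) - 1) * √(1 + ∑ k, dirDeriv (e k) F p ^ 2) with hw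
  have hwc : ContinuousOn w C := by
    intro p hp
    have h1 := (cφ p (hCO hp)).continuousAt
    have h2 : ∀ k, ContinuousAt (dirDeriv (e k) F) p := fun k =>
      ((cF p (hCO hp)).dirDeriv (m := 2) (e k) (by norm_num)).continuousAt
    have : ContinuousAt w p := by
      simp only [hw]
      fun_prop
    exact this.continuousWithinAt
  have h0C : ((0 : EuclideanSpace ℝ (Fin n)), T) ∈ C := by
    refine ⟨?_, by simp, by simp [hT.le]⟩
    simp [parabolicCutoff, hT.ne']
    norm_num
  have hφ0 : φ (0, T) = 1 / 4 := by
    simp only [hφ, hF, hval, parabolicCutoff]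
    simp [hT.ne']
    field_simp
    norm_num
  obtain ⟨z, hzC, hzmax⟩ := hCc.exists_isMaxOn ⟨_, h0C⟩ hwc
  have hzO := hCO hzC
  have hw0 : 0 < w (0, T) := by
    simp only [hw, hφ0]
    refine mul_pos ?_ (Real.sqrt_pos.2 (by positivity))
    rw [sub_pos, Real.one_lt_exp_iff]
    linarith
  have hφz : 0 < φ z := by
    have h1 : 0 < w z := hw0.trans_le (hzmax h0C)
    have h2 := pos_of_mul_pos_left h1 (Real.sqrt_nonneg _)
    rw [sub_pos, Real.one_lt_exp_iff] at h2
    exact pos_of_mul_pos_right h2 (by linarith)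
  have hFz : 0 < F z := hpos z.1 z.2 hzO
  have hψF : φ z < parabolicCutoff T z := by
    have : 0 < 1 / (2 * v₀) * F z := by positivity
    simp only [hφ]
    linarith
  obtain ⟨-, hz1, hz2, hz3⟩ := hzC
  rw [mem_closedBall_zero_iff] at hz1
  have hρ0 : 0 ≤ z.2 / T := by positivity
  have hρ1 : z.2 / T ≤ 1 := (div_le_one hT).2 hz3
  have hψz : parabolicCutoff T z ≤ 3 / 4 := by
    simp only [parabolicCutoff, hnorm]
    have : z.2 / T * (1 - ‖z.1‖ ^ 2) ≤ 1 * 1 := by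
      refine mul_le_mul hρ1 ?_ ?_ zero_le_one <;> nlinarith [norm_nonneg z.1]
    linarith
  have hmax : ∀ᶠ y in 𝓝[{p | p.2 ≤ T}] z, w y ≤ w z := by
    have h1 : ∀ᶠ y in 𝓝 z, 0 < parabolicCutoff T y :=
      (contDiff_parabolicCutoff (m := 0) T).continuous.continuousAt.eventually
        (lt_mem_nhds (hφz.trans hψF))
    filter_upwards [h1.filter_mono nhdsWithin_le_nhds,
      nhdsWithin_le_nhds (hOo.mem_nhds hzO), self_mem_nhdsWithin] with y hy hyO hyT
    exact hzmax ⟨hy.le, Metric.ball_subset_closedBall hyO.1, hyO.2.1.le, hyT⟩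
  have hkey := cutoff_inequality_of_isMax (cF z hzO)
    (by filter_upwards [hOo.mem_nhds hzO] with y hy using hE y hy) (fun i => rfl) (cφ z hzO)
    (by linarith) hφz (N := {p | p.2 ≤ T}) hmax
    (fun ξ s => by simpa [he, Prod.snd_sum] using hz3)
    (fun s hs => by
      simp only [Set.mem_ofPred_eq, Prod.snd_add, Prod.smul_snd, smul_eq_mul]
      linarith)
  have hφ1 : ∀ p ∈ O, ∀ a, dirDeriv a φ p =
      -(1 / (2 * v₀)) * dirDeriv a F p + dirDeriv a (parabolicCutoff T) p := by
    intro p hp a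
    rw [hφ, dirDeriv_add ((dF p hp).const_mul _)
      ((contDiff_parabolicCutoff (m := 1) T).differentiable (by norm_num) p),
      dirDeriv_mul (differentiableAt_const _) (dF p hp)]
    simp [dirDeriv]
  have hφ2 : ∀ a b, dirDeriv a (dirDeriv b φ) z =
      -(1 / (2 * v₀)) * dirDeriv a (dirDeriv b F) z
        + dirDeriv a (dirDeriv b (parabolicCutoff T)) z := by
    intro a b
    have hev : dirDeriv b φ =ᶠ[𝓝 z] fun p =>
        -(1 / (2 * v₀)) * dirDeriv b F p + dirDeriv b (parabolicCutoff T) p := by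
      filter_upwards [hOo.mem_nhds hzO] with p hp using hφ1 p hp b
    have d1 := ((cF z hzO).dirDeriv (m := 2) b (by norm_num)).differentiableAt (by norm_num)
    have d2 := (((contDiff_parabolicCutoff (n := n) (m := 2) T).contDiffAt (x := z)).dirDeriv
      (m := 1) b (by norm_num)).differentiableAt (by norm_num)
    rw [(hev.dirDeriv a).eq_of_nhds, dirDeriv_add (d1.const_mul _) d2,
      dirDeriv_mul (differentiableAt_const _) d1]
    simp [dirDeriv]
  simp only [hφ2, hφ1 z hzO, hE z hzO, he, dirDeriv_dirDeriv_single_parabolicCutoff, mcOp_add,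
    mcOp_mul_left] at hkey
  simp only [dirDeriv_single_parabolicCutoff] at hkey
  have hκ : dirDeriv (0, 1) (parabolicCutoff T) z ≤ 1 / T := by
    rw [dirDeriv_parabolicCutoff, hnorm]
    simp only [PiLp.zero_apply, mul_zero, Finset.sum_const_zero, sub_zero]
    have : 1 / T * (1 - ‖z.1‖ ^ 2) ≤ 1 / T * 1 := by
      gcongr
      linarith [sq_nonneg ‖z.1‖]
    linarith
  have hX : ∑ i, (-(2 * (z.2 / T)) * z.1 i) ^ 2 ≤ 4 := by
    simp only [mul_pow, ← Finset.mul_sum, hnorm]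
    have h1 : (z.2 / T) ^ 2 ≤ 1 := pow_le_one₀ hρ0 hρ1
    have h2 : ‖z.1‖ ^ 2 ≤ 1 := pow_le_one₀ (norm_nonneg _) hz1
    nlinarith [sq_nonneg (z.2 / T)]
  have hgrad := sqrt_sum_sq_lt_of_cutoff_inequality hA hT hv₀ hρ0 hρ1 hκ hX hK hkey
  refine le_mul_exp_of_max_comparison hK2 (by linarith) (Real.sqrt_nonneg _) hgrad.le
    (hψF.le.trans hψz) ?_
  have hcmp := hzmax h0C
  simp only [Set.mem_ofPred_eq, hw, hφ0] at hcmp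
  rw [Real.sq_sqrt (by positivity), Real.sq_sqrt (by positivity)]
  simpa only [pd_eq_dirDeriv (dF _ (hCO h0C))] using hcmp
end
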